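/- Assume the DVV hypothesis stated in the context and define, for n ≥ 2 and w > 0, T_n(w) = Σ_{g≥0,k≥1, 2g−1+k=n, 2g−2+k>0} (1/k!)·Ω_{g,k}(w,…,w). Then for every integer n ≥ 3 and every w > 0: w^{5/2}·T_n′(w) = w^{5/2}·(d/dw)( w^{5/2}·T_{n−1}′(w) ) + w⁵·Σ_{i+j=n, i,j≥2} T_i′(w)·T_j′(w). -/

import Mathlib

open Finset

/-- Real value of the double factorial `k‼` of an integer (with `k‼ = 1` for `k ≤ 0`,
in particular `(-1)‼ = 1`). -/
noncomputable def dfac (k : ℤ) : ℝ := (Nat.doubleFactorial k.toNat : ℝ)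

/-- The rescaled correlator `⟨τ̃_{a_1} ⋯ τ̃_{a_n}⟩_g` with `τ̃_a = (2a+1)!! τ_a`. -/
noncomputable def ttau (τ : ℤ → (n : ℕ) → (Fin n → ℤ) → ℝ) (g : ℤ) (n : ℕ)
    (a : Fin n → ℤ) : ℝ :=
  (∏ i, dfac (2 * a i + 1)) * τ g n a

/-- The DVV hypothesis: a symmetric family of correlators `⟨τ_{a_1} ⋯ τ_{a_n}⟩_g`,
vanishing unless `2g-2+n > 0`, all indices are nonnegative and `∑ aᵢ = 3g-3+n`
(in particular vanishing for `g < 0`), satisfying the Dijkgraaf–Verlinde–Verlinde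
(Virasoro) recursion relations. -/
structure DVVFamily (τ : ℤ → (n : ℕ) → (Fin n → ℤ) → ℝ) : Prop where
  symm : ∀ (g : ℤ) (n : ℕ) (a : Fin n → ℤ) (σ : Equiv.Perm (Fin n)), τ g n (a ∘ σ) = τ g n a
  vanish : ∀ (g : ℤ) (n : ℕ) (a : Fin n → ℤ),
      ¬((∀ i, 0 ≤ a i) ∧ 0 < 2 * g - 2 + (n : ℤ) ∧ (∑ i, a i) = 3 * g - 3 + n) → τ g n a = 0
  dvv : ∀ (g : ℤ) (n : ℕ), 0 ≤ g → 3 ≤ 2 * g + (n : ℤ) → ∀ (a₀ : ℤ) (a : Fin n → ℤ),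
      0 ≤ a₀ → (∀ i, 0 ≤ a i) →
      ttau τ g (n + 1) (Fin.cons a₀ a) =
        (∑ i, (2 * (a i : ℝ) + 1) * ttau τ g n (Function.update a i (a₀ + a i - 1)))
        + (1 / 2) * ∑ b₁ ∈ Finset.Icc (0 : ℤ) (a₀ - 2),
            (ttau τ (g - 1) (n + 2) (Fin.cons b₁ (Fin.cons (a₀ - 2 - b₁) a))
             + ∑ g₁ ∈ Finset.Icc (0 : ℤ) g, ∑ A ∈ (univ : Finset (Fin n)).powerset,
                if 0 < 2 * g₁ - 1 + (A.card : ℤ) ∧ 0 < 2 * (g - g₁) - 1 + ((Aᶜ).card : ℤ) then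
                  ttau τ g₁ (A.card + 1) (Fin.cons b₁ (fun j => a (A.orderIsoOfFin rfl j).1))
                  * ttau τ (g - g₁) ((Aᶜ).card + 1)
                      (Fin.cons (a₀ - 2 - b₁) (fun j => a ((Aᶜ).orderIsoOfFin rfl j).1))
                else 0)

/-- The antiderivative generating function
`Ω_{g,n}(w_1,…,w_n) = ∑ ⟨τ_{a_1}⋯τ_{a_n}⟩_g ∏ (2aᵢ-1)!! wᵢ^{aᵢ+1/2}` (with `(-1)!! = 1`),
written as a finite sum over `0 ≤ aᵢ ≤ 3g-3+n`. -/
noncomputable def OmegaF (τ : ℤ → (n : ℕ) → (Fin n → ℤ) → ℝ) (g : ℤ) (n : ℕ)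
    (w : Fin n → ℝ) : ℝ :=
  ∑ a : Fin n → Fin ((3 * g + n - 3).toNat + 1),
    τ g n (fun i => ((a i : ℕ) : ℤ))
      * ∏ i, dfac (2 * ((a i : ℕ) : ℤ) - 1) * w i ^ (((a i : ℕ) : ℝ) + 1 / 2)

/-- `T_n(w) = Σ_{g≥0,k≥1, 2g-1+k=n, (g,k) stable} (1/k!) Ω_{g,k}(w,…,w)`;
for `n ≥ 2` the stable pairs are exactly `(g, k)` with `k = (n-2g)+1` and `2g ≤ n`. -/
noncomputable def Tfun (τ : ℤ → (n : ℕ) → (Fin n → ℤ) → ℝ) (n : ℕ) (w : ℝ) : ℝ :=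
  ∑ g ∈ Finset.range (n + 1),
    if 2 * g ≤ n then
      (1 / (Nat.factorial (n - 2 * g + 1) : ℝ)) * OmegaF τ g ((n - 2 * g) + 1) (fun _ => w)
    else 0

/-- Tuples of length `n` with entries in `{0, …, M}`. -/
noncomputable def indexBox (M : ℤ) (n : ℕ) : Finset (Fin n → ℤ) :=
  Fintype.piFinset fun _ => Finset.Icc 0 M

/-- The weight `∏ (2aᵢ+1)⁻¹` of an index tuple. -/
noncomputable def tupleWeight {n : ℕ} (a : Fin n → ℤ) : ℝ := ∏ i, (2 * (a i : ℝ) + 1)⁻¹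

theorem mem_indexBox {M : ℤ} {n : ℕ} {a : Fin n → ℤ} :
    a ∈ indexBox M n ↔ ∀ i, 0 ≤ a i ∧ a i ≤ M := by
  simp [indexBox, Fintype.mem_piFinset]

theorem tupleWeight_cons {n : ℕ} (x : ℤ) (a : Fin n → ℤ) :
    tupleWeight (Fin.cons x a : Fin (n + 1) → ℤ) = (2 * (x : ℝ) + 1)⁻¹ * tupleWeight a := by
  simp only [tupleWeight, Fin.prod_univ_succ, Fin.cons_zero, Fin.cons_succ]

theorem tupleWeight_comp_perm {n : ℕ} (a : Fin n → ℤ) (σ : Equiv.Perm (Fin n)) :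
    tupleWeight (a ∘ σ) = tupleWeight a :=
  Equiv.prod_comp σ fun i => (2 * (a i : ℝ) + 1)⁻¹

theorem sum_indexBox_succ (M : ℤ) (n : ℕ) (F : (Fin (n + 1) → ℤ) → ℝ) :
    ∑ a ∈ indexBox M (n + 1), F a =
      ∑ x ∈ Finset.Icc 0 M, ∑ a ∈ indexBox M n, F (Fin.cons x a) := by
  rw [← Finset.sum_product']
  refine Finset.sum_nbij' (fun a => (a 0, Fin.tail a)) (fun p => Fin.cons p.1 p.2) ?_ ?_ ?_ ?_ ?_
  · intro a ha
    rw [mem_indexBox] at ha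
    simp only [Finset.mem_product, Finset.mem_Icc, mem_indexBox]
    exact ⟨ha 0, fun i => ha i.succ⟩
  · rintro ⟨x, a⟩ hp
    simp only [Finset.mem_product, Finset.mem_Icc, mem_indexBox] at hp
    rw [mem_indexBox]
    intro i
    refine Fin.cases ?_ (fun j => ?_) i
    · simpa using hp.1
    · simpa using hp.2 j
  · intro a _
    simp
  · rintro ⟨x, a⟩ _
    simp
  · intro a _
    simp

theorem sum_indexBox_comp_perm (M : ℤ) {n : ℕ} (σ : Equiv.Perm (Fin n))
    (F : (Fin n → ℤ) → ℝ) :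
    ∑ a ∈ indexBox M n, F (a ∘ σ) = ∑ a ∈ indexBox M n, F a := by
  refine Finset.sum_nbij' (fun a => a ∘ σ) (fun a => a ∘ σ.symm) ?_ ?_ ?_ ?_ ?_
  · intro a ha
    rw [mem_indexBox] at ha ⊢
    exact fun i => ha _
  · intro a ha
    rw [mem_indexBox] at ha ⊢
    exact fun i => ha _
  · intro a _
    ext i
    simp
  · intro a _
    ext i
    simp
  · intro a _
    rfl

/-- If the functions `Φ i` are exchanged by transpositions, all of them have the same sum
over a box. -/
theorem sum_sum_indexBox_of_swap (M : ℤ) {n : ℕ} (Φ : Fin (n + 1) → (Fin (n + 1) → ℤ) → ℝ)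
    (hΦ : ∀ i a, Φ i (a ∘ Equiv.swap 0 i) = Φ 0 a) :
    ∑ a ∈ indexBox M (n + 1), ∑ i, Φ i a = (n + 1) * ∑ a ∈ indexBox M (n + 1), Φ 0 a := by
  rw [Finset.sum_comm]
  have : ∀ i, ∑ a ∈ indexBox M (n + 1), Φ i a = ∑ a ∈ indexBox M (n + 1), Φ 0 a := by
    intro i
    rw [← sum_indexBox_comp_perm M (Equiv.swap 0 i)]
    exact Finset.sum_congr rfl fun a _ => hΦ i a
  simp [this]

theorem sum_indexBox_split (M : ℤ) {n : ℕ} (A : Finset (Fin n))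
    (f : (Fin A.card → ℤ) → ℝ) (g : (Fin Aᶜ.card → ℤ) → ℝ) :
    ∑ a ∈ indexBox M n, tupleWeight a *
        (f (fun j => a (A.orderIsoOfFin rfl j).1) * g (fun j => a (Aᶜ.orderIsoOfFin rfl j).1)) =
      (∑ b ∈ indexBox M A.card, tupleWeight b * f b) *
        ∑ c ∈ indexBox M Aᶜ.card, tupleWeight c * g c := by
  set e := finSumEquivOfFinset (s := A) rfl rfl with he
  have hl : ∀ j, e (Sum.inl j) = (A.orderIsoOfFin rfl j).1 := fun j => by simp [he]
  have hr : ∀ j, e (Sum.inr j) = (Aᶜ.orderIsoOfFin rfl j).1 := fun j => by simp [he]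
  rw [Finset.sum_mul_sum, ← Finset.sum_product']
  refine Finset.sum_nbij' (fun a => (fun j => a (e (Sum.inl j)), fun j => a (e (Sum.inr j))))
    (fun p => Sum.elim p.1 p.2 ∘ e.symm) ?_ ?_ ?_ ?_ ?_
  · intro a ha
    rw [mem_indexBox] at ha
    simp only [Finset.mem_product, mem_indexBox]
    exact ⟨fun j => ha _, fun j => ha _⟩
  · rintro ⟨b, c⟩ hp
    simp only [Finset.mem_product, mem_indexBox] at hp
    rw [mem_indexBox]
    intro i
    obtain ⟨j | j, rfl⟩ := e.surjective i
    · simpa using hp.1 j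
    · simpa using hp.2 j
  · intro a _
    ext i
    obtain ⟨j | j, rfl⟩ := e.surjective i <;> simp
  · rintro ⟨b, c⟩ _
    simp
  · intro a _
    have hw : tupleWeight a = tupleWeight (fun j => a (e (Sum.inl j))) *
        tupleWeight (fun j => a (e (Sum.inr j))) := by
      unfold tupleWeight
      rw [← Equiv.prod_comp e, Fintype.prod_sum_type]
    simp only [← hl, ← hr, hw]
    ring

theorem sum_Icc_sum_Icc_add_sub_one (M : ℤ) (F : ℤ → ℝ) (hneg : ∀ m, m < 0 → F m = 0)
    (hM : ∀ m, M ≤ m → F m = 0) :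
    ∑ x ∈ Finset.Icc 0 M, ∑ y ∈ Finset.Icc 0 M, F (x + y - 1) =
      ∑ m ∈ Finset.Icc 0 M, ((m : ℝ) + 2) * F m := by
  have h1 : ∀ x ∈ Finset.Icc 0 M, ∑ y ∈ Finset.Icc 0 M, F (x + y - 1) =
      ∑ m ∈ Finset.Icc 0 M, if x ≤ m + 1 then F m else 0 := by
    intro x hx
    rw [Finset.mem_Icc] at hx
    rw [← Finset.sum_filter]
    refine Finset.sum_bij_ne_zero (fun y _ _ => x + y - 1) ?_ ?_ ?_ ?_
    · intro y hy h0
      rw [Finset.mem_Icc] at hy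
      rw [Finset.mem_filter, Finset.mem_Icc]
      have h2 := mt (hneg _) h0
      have h3 := mt (hM _) h0
      omega
    · intro y _ _ z _ _ h
      omega
    · intro m hm h0
      rw [Finset.mem_filter, Finset.mem_Icc] at hm
      have h3 := mt (hM _) h0
      have h4 : x + (m + 1 - x) - 1 = m := by ring
      refine ⟨m + 1 - x, ?_, ?_, h4⟩
      · rw [Finset.mem_Icc]
        omega
      · rwa [h4]
    · intro y _ _
      rfl
  rw [Finset.sum_congr rfl h1, Finset.sum_comm]
  refine Finset.sum_congr rfl fun m hm => ?_
  rw [Finset.mem_Icc] at hm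
  rcases le_or_gt M m with h | h
  · simp [hM m h]
  · rw [← Finset.sum_filter, Finset.sum_const]
    have : (Finset.Icc 0 M).filter (fun x => x ≤ m + 1) = Finset.Icc 0 (m + 1) := by
      ext x
      rw [Finset.mem_filter, Finset.mem_Icc, Finset.mem_Icc]
      omega
    rw [this, Int.card_Icc, nsmul_eq_mul]
    congr 1
    have h5 : (((m + 1 + 1 - 0).toNat : ℤ) : ℝ) = ((m + 2 : ℤ) : ℝ) := by
      congr 1
      omega
    push_cast at h5
    simpa using h5

theorem sum_Icc_sum_Icc_sub_two (M : ℤ) (G : ℤ → ℤ → ℝ) (hG : ∀ b c, M < b + c + 2 → G b c = 0) :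
    ∑ x ∈ Finset.Icc 0 M, ∑ b ∈ Finset.Icc 0 (x - 2), G b (x - 2 - b) =
      ∑ b ∈ Finset.Icc 0 M, ∑ c ∈ Finset.Icc 0 M, G b c := by
  rw [← Finset.sum_product', Finset.sum_sigma']
  refine Finset.sum_bij_ne_zero (fun p _ _ => (p.2, p.1 - 2 - p.2)) ?_ ?_ ?_ ?_
  · rintro ⟨x, b⟩ h _
    simp only [Finset.mem_sigma, Finset.mem_Icc] at h
    simp only [Finset.mem_product, Finset.mem_Icc]
    omega
  · rintro ⟨x, b⟩ _ _ ⟨y, c⟩ _ _ h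
    simp only [Prod.mk.injEq] at h
    obtain ⟨rfl, h⟩ := h
    obtain rfl : x = y := by omega
    rfl
  · rintro ⟨b, c⟩ h h0
    simp only [Finset.mem_product, Finset.mem_Icc] at h
    have h3 := mt (hG b c) h0
    have h4 : b + c + 2 - 2 - b = c := by ring
    refine ⟨⟨b + c + 2, b⟩, ?_, ?_, ?_⟩
    · simp only [Finset.mem_sigma, Finset.mem_Icc]
      omega
    · simpa [h4] using h0
    · simp
  · intro p _ _
    rfl

/-- The summand attached to the subset `A` of `s` in the genus zero splitting identity
`sum_splitTerm`. -/
noncomputable def splitTerm {ι : Type*} (s : Finset ι) (a : ι → ℕ) (A : Finset ι) : ℝ :=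
  if ∑ i ∈ A, a i + 2 = A.card then
    ((A.card - 2).factorial : ℝ) * ((s.card - A.card - 2).factorial : ℝ)
  else 0

theorem splitTerm_sdiff {ι : Type*} [DecidableEq ι] (s : Finset ι) (a : ι → ℕ)
    (hs : ∑ i ∈ s, a i + 4 = s.card) {A : Finset ι} (hA : A ⊆ s) :
    splitTerm s a (s \ A) = splitTerm s a A := by
  have h1 := Finset.sum_sdiff (f := a) hA
  have h2 := Finset.card_sdiff_add_card_eq_card hA
  unfold splitTerm
  by_cases hc : ∑ i ∈ A, a i + 2 = A.card
  · have hc' : ∑ i ∈ s \ A, a i + 2 = (s \ A).card := by omega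
    rw [if_pos hc, if_pos hc', mul_comm]
    congr 3 <;> omega
  · have hc' : ¬ ∑ i ∈ s \ A, a i + 2 = (s \ A).card := by omega
    rw [if_neg hc, if_neg hc']

theorem sum_powerset_splitTerm {ι : Type*} [DecidableEq ι] (s : Finset ι) (a : ι → ℕ)
    (hs : ∑ i ∈ s, a i + 4 = s.card) {j : ι} (hj : j ∈ s) :
    ∑ A ∈ s.powerset, splitTerm s a A =
      2 * ∑ A ∈ s.powerset with j ∈ A, splitTerm s a A := by
  rw [← Finset.sum_filter_add_sum_filter_not _ (fun A => j ∈ A), two_mul]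
  congr 1
  refine Finset.sum_nbij' (fun A => s \ A) (fun A => s \ A) ?_ ?_ ?_ ?_ ?_
  · intro A hA
    simp only [Finset.mem_filter, Finset.mem_powerset, Finset.mem_sdiff] at hA ⊢
    exact ⟨Finset.sdiff_subset, hj, hA.2⟩
  · intro A hA
    simp only [Finset.mem_filter, Finset.mem_powerset, Finset.mem_sdiff] at hA ⊢
    exact ⟨Finset.sdiff_subset, fun h => h.2 hA.2⟩
  · intro A hA
    simp only [Finset.mem_filter, Finset.mem_powerset] at hA
    exact Finset.sdiff_sdiff_eq_self hA.1
  · intro A hA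
    simp only [Finset.mem_filter, Finset.mem_powerset] at hA
    exact Finset.sdiff_sdiff_eq_self hA.1
  · intro A hA
    simp only [Finset.mem_filter, Finset.mem_powerset] at hA
    exact (splitTerm_sdiff s a hs hA.1).symm

theorem sum_splitTerm_mem_of_pos {ι : Type*} [DecidableEq ι] (t : Finset ι) (a : ι → ℕ)
    {j : ι} (haj : 1 ≤ a j) :
    ∑ B ∈ t.powerset with j ∈ B, splitTerm t (Function.update a j (a j - 1)) B =
      ∑ B ∈ t.powerset with j ∈ B, if ∑ i ∈ B, a i + 1 = B.card then
        ((B.card - 2).factorial : ℝ) * ((t.card - B.card - 2).factorial : ℝ) else 0 := by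
  refine Finset.sum_congr rfl fun B hB => ?_
  have hjB := (Finset.mem_filter.mp hB).2
  have h1 := Finset.sum_update_of_mem hjB a (a j - 1)
  have h2 := Finset.sum_sdiff (f := a) (Finset.singleton_subset_iff.mpr hjB)
  rw [Finset.sum_singleton] at h2
  unfold splitTerm
  refine if_congr ?_ rfl rfl
  omega

theorem sum_splitTerm {ι : Type*} [DecidableEq ι] (s : Finset ι) (a : ι → ℕ)
    (hs : ∑ i ∈ s, a i + 4 = s.card) :
    ∑ A ∈ s.powerset, splitTerm s a A =
      ((s.card - 3).factorial : ℝ) * (2 * ∑ i ∈ s, ((a i : ℝ) + 1)⁻¹ - ((s.card : ℝ) - 2)) := by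
  induction hm : s.card generalizing s a with
  | zero => omega
  | succ m ih =>
    obtain ⟨z, hz, haz⟩ : ∃ z ∈ s, a z = 0 := by
      by_contra! hne
      have : s.card ≤ ∑ i ∈ s, a i := by
        simpa using Finset.card_nsmul_le_sum s a 1 fun i hi => Nat.one_le_iff_ne_zero.mpr (hne i hi)
      omega
    rw [sum_powerset_splitTerm s a hs hz]
    set t := s.erase z with ht
    have hzt : z ∉ t := Finset.notMem_erase z s
    have hst : s = insert z t := (Finset.insert_erase hz).symm
    have htc : t.card = m := by rw [ht, Finset.card_erase_of_mem hz, hm]; rfl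
    have htsum : ∑ i ∈ t, a i + 3 = m := by
      rw [hst, Finset.sum_insert hzt, haz] at hs
      rw [hst] at hm
      omega
    set S := ∑ i ∈ t, ((a i : ℝ) + 1)⁻¹ with hS
    have hS' : ∑ i ∈ s, ((a i : ℝ) + 1)⁻¹ = 1 + S := by
      rw [hst, Finset.sum_insert hzt, haz]
      simp [hS]
    set G : Finset ι → ℝ := fun B => if ∑ i ∈ B, a i + 1 = B.card then
        ((B.card - 2).factorial : ℝ) * ((t.card - B.card - 2).factorial : ℝ) else 0 with hG
    have hinsert : ∑ A ∈ s.powerset with z ∈ A, splitTerm s a A =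
        ∑ B ∈ t.powerset, splitTerm s a (insert z B) := by
      symm
      refine Finset.sum_nbij' (fun B => insert z B) (fun A => A.erase z) ?_ ?_ ?_ ?_ ?_
      · intro B hB
        rw [Finset.mem_powerset] at hB
        rw [Finset.mem_filter, Finset.mem_powerset, hst]
        exact ⟨Finset.insert_subset_insert _ hB, Finset.mem_insert_self _ _⟩
      · intro A hA
        rw [Finset.mem_filter, Finset.mem_powerset] at hA
        rw [Finset.mem_powerset]
        exact Finset.erase_subset_erase _ hA.1
      · intro B hB
        rw [Finset.mem_powerset] at hB
        exact Finset.erase_insert fun h => hzt (hB h)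
      · intro A hA
        exact Finset.insert_erase (Finset.mem_filter.mp hA).2
      · intro B _
        rfl
    have hterm : ∀ B ∈ t.powerset, splitTerm s a (insert z B) =
        (if B.card = 1 then if ∑ i ∈ B, a i = 0 then ((m - 3).factorial : ℝ) else 0 else 0) +
          ∑ j ∈ B, (a j : ℝ) * G B := by
      intro B hB
      rw [Finset.mem_powerset] at hB
      have hzB : z ∉ B := fun h => hzt (hB h)
      rw [splitTerm, Finset.sum_insert hzB, Finset.card_insert_of_notMem hzB, haz, hm,
        ← Finset.sum_mul]
      by_cases hc : ∑ i ∈ B, a i + 1 = B.card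
      · rw [if_pos (by omega)]
        have hsumB : ∑ i ∈ B, (a i : ℝ) = (B.card : ℝ) - 1 := by
          rw [← hc]
          push_cast
          ring
        simp only [hG, if_pos hc, hsumB]
        by_cases h1 : B.card = 1
        · rw [if_pos h1, if_pos (by omega), h1, show m + 1 - (1 + 1) - 2 = m - 3 by omega]
          simp
        · obtain ⟨k, hk⟩ : ∃ k, B.card = k + 2 := ⟨B.card - 2, by omega⟩
          rw [if_neg h1, hk, htc, show m + 1 - (k + 2 + 1) - 2 = m - (k + 2) - 2 by omega,
            show k + 2 + 1 - 2 = k + 1 by omega, show k + 2 - 2 = k by omega,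
            Nat.factorial_succ]
          push_cast
          ring
      · rw [if_neg (by omega)]
        have : (if B.card = 1 then if ∑ i ∈ B, a i = 0 then ((m - 3).factorial : ℝ) else 0
            else 0) = 0 := by
          split_ifs <;> first | rfl | omega
        rw [this]
        simp only [hG, if_neg hc]
        simp
    have hsingle : (∑ B ∈ t.powerset,
        if B.card = 1 then if ∑ i ∈ B, a i = 0 then ((m - 3).factorial : ℝ) else 0 else 0) =
        ∑ j ∈ t, if a j = 0 then ((m - 3).factorial : ℝ) else 0 := by
      rw [← Finset.sum_filter, ← Finset.powersetCard_eq_filter, Finset.powersetCard_one,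
        Finset.sum_map]
      simp
    have hmarked : ∀ j ∈ t, 2 * ((a j : ℝ) * ∑ B ∈ t.powerset with j ∈ B, G B) =
        ((m - 3).factorial : ℝ) * ((a j : ℝ) * (2 * S - ((m : ℝ) - 2)) +
          if a j = 0 then 0 else 2 * ((a j : ℝ) + 1)⁻¹) := by
      intro j hj
      by_cases haj : a j = 0
      · simp [haj]
      · set a' := Function.update a j (a j - 1) with ha'
        have hd := Finset.singleton_subset_iff.mpr hj
        have h1 : ∑ i ∈ t, a' i = a j - 1 + ∑ i ∈ t \ {j}, a i :=
          Finset.sum_update_of_mem hj a (a j - 1)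
        have h2 := Finset.sum_sdiff (f := a) hd
        rw [Finset.sum_singleton] at h2
        have hs' : ∑ i ∈ t, a' i + 4 = t.card := by omega
        have h3 := ih t a' hs' htc
        rw [sum_powerset_splitTerm t a' hs' hj,
          sum_splitTerm_mem_of_pos t a (j := j) (by omega)] at h3
        have h4 : ∑ i ∈ t, ((a' i : ℝ) + 1)⁻¹ = S - ((a j : ℝ) + 1)⁻¹ + (a j : ℝ)⁻¹ := by
          rw [hS, ← Finset.sum_sdiff hd, ← Finset.sum_sdiff (f := fun i => ((a i : ℝ) + 1)⁻¹) hd,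
            Finset.sum_singleton, Finset.sum_singleton, ha', Function.update_self]
          have h5 : ∑ x ∈ t \ {j}, ((Function.update a j (a j - 1) x : ℝ) + 1)⁻¹ =
              ∑ x ∈ t \ {j}, ((a x : ℝ) + 1)⁻¹ := by
            refine Finset.sum_congr rfl fun x hx => ?_
            rw [Function.update_of_ne]
            rintro rfl
            simp at hx
          rw [h5, Nat.cast_sub (by omega)]
          simp
        rw [h4] at h3
        have h6 : (a j : ℝ) ≠ 0 := by exact_mod_cast haj
        have h7 : (a j : ℝ) + 1 ≠ 0 := by positivity
        rw [if_neg haj, mul_left_comm, h3]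
        field_simp
        ring
    have hcomm : ∑ B ∈ t.powerset, ∑ j ∈ B, (a j : ℝ) * G B =
        ∑ j ∈ t, (a j : ℝ) * ∑ B ∈ t.powerset with j ∈ B, G B := by
      simp_rw [Finset.mul_sum]
      refine Finset.sum_comm' fun B j => ?_
      simp only [Finset.mem_powerset, Finset.mem_filter]
      exact ⟨fun h => ⟨h, h.1 h.2⟩, fun h => h.1⟩
    have hcombine : ∀ j ∈ t, 2 * (if a j = 0 then ((m - 3).factorial : ℝ) else 0) +
        ((m - 3).factorial : ℝ) * ((a j : ℝ) * (2 * S - ((m : ℝ) - 2)) +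
          if a j = 0 then 0 else 2 * ((a j : ℝ) + 1)⁻¹) =
        ((m - 3).factorial : ℝ) *
          ((a j : ℝ) * (2 * S - ((m : ℝ) - 2)) + 2 * ((a j : ℝ) + 1)⁻¹) := by
      intro j _
      split_ifs with h0
      · simp [h0]
        ring
      · ring
    have hreal : ∑ j ∈ t, (a j : ℝ) = (m : ℝ) - 3 := by
      rw [← htsum]
      push_cast
      ring
    rw [hinsert, Finset.sum_congr rfl hterm, Finset.sum_add_distrib, hsingle, hcomm, mul_add,
      Finset.mul_sum, Finset.mul_sum, Finset.sum_congr rfl hmarked, ← Finset.sum_add_distrib,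
      Finset.sum_congr rfl hcombine, ← Finset.mul_sum, Finset.sum_add_distrib,
      ← Finset.sum_mul, ← Finset.mul_sum, ← hS, hreal, hS']
    obtain ⟨k, rfl⟩ : ∃ k, m = k + 3 := ⟨m - 3, by omega⟩
    rw [show k + 3 + 1 - 3 = k + 1 by omega, show k + 3 - 3 = k by omega, Nat.factorial_succ]
    push_cast
    ring

theorem dfac_two_mul_add_one (a : ℤ) (ha : 0 ≤ a) :
    dfac (2 * a + 1) = (2 * (a : ℝ) + 1) * dfac (2 * a - 1) := by
  obtain ⟨m, rfl⟩ := Int.eq_ofNat_of_zero_le ha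
  cases m with
  | zero => simp [dfac]
  | succ k =>
    have h1 : (2 * ((k + 1 : ℕ) : ℤ) + 1).toNat = (2 * k + 1) + 2 := by omega
    have h2 : (2 * ((k + 1 : ℕ) : ℤ) - 1).toNat = 2 * k + 1 := by omega
    rw [dfac, dfac, h1, h2, Nat.doubleFactorial_add_two]
    push_cast
    ring

theorem two_mul_cast_add_one_ne_zero (a : ℤ) : (2 * (a : ℝ) + 1) ≠ 0 := by
  have : (2 * a + 1 : ℤ) ≠ 0 := by omega
  exact_mod_cast this

theorem tupleWeight_mul_prod_dfac {n : ℕ} (a : Fin n → ℤ) (ha : ∀ i, 0 ≤ a i) :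
    tupleWeight a * ∏ i, dfac (2 * a i + 1) = ∏ i, dfac (2 * a i - 1) := by
  rw [tupleWeight, ← Finset.prod_mul_distrib]
  refine Finset.prod_congr rfl fun i _ => ?_
  rw [dfac_two_mul_add_one _ (ha i), inv_mul_cancel_left₀ (two_mul_cast_add_one_ne_zero _)]

section Correlators

variable {τ : ℤ → (n : ℕ) → (Fin n → ℤ) → ℝ}

theorem ttau_comp_perm (h : DVVFamily τ) (g : ℤ) {n : ℕ} (a : Fin n → ℤ)
    (σ : Equiv.Perm (Fin n)) : ttau τ g n (a ∘ σ) = ttau τ g n a := by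
  rw [ttau, ttau, h.symm]
  congr 1
  exact Equiv.prod_comp σ fun i => dfac (2 * a i + 1)

theorem ttau_cons_comp_perm (h : DVVFamily τ) (g : ℤ) {n : ℕ} (x : ℤ) (a : Fin n → ℤ)
    (σ : Equiv.Perm (Fin n)) :
    ttau τ g (n + 1) (Fin.cons x (a ∘ σ)) = ttau τ g (n + 1) (Fin.cons x a) := by
  rw [← ttau_comp_perm h g (Fin.cons x a) (Equiv.Perm.decomposeFin.symm (0, σ))]
  congr 1
  ext i
  refine Fin.cases ?_ (fun j => ?_) i <;> simp

theorem ttau_eq_zero (h : DVVFamily τ) {g : ℤ} {n : ℕ} {a : Fin n → ℤ}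
    (ha : ¬((∀ i, 0 ≤ a i) ∧ 0 < 2 * g - 2 + (n : ℤ) ∧ (∑ i, a i) = 3 * g - 3 + n)) :
    ttau τ g n a = 0 := by
  rw [ttau, h.vanish g n a ha, mul_zero]

theorem ttau_cons_eq_zero_of_lt (h : DVVFamily τ) {g : ℤ} {n : ℕ} {x : ℤ} {a : Fin n → ℤ}
    (hx : 3 * g - 2 + n < x) : ttau τ g (n + 1) (Fin.cons x a) = 0 := by
  refine ttau_eq_zero h ?_
  rintro ⟨h0, -, h2⟩
  rw [Fin.sum_univ_succ] at h2
  simp only [Fin.cons_zero, Fin.cons_succ] at h2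
  have : 0 ≤ ∑ i, a i := Finset.sum_nonneg fun i _ => by simpa using h0 i.succ
  push_cast at h2
  omega

theorem ttau_cons_eq_zero_of_neg (h : DVVFamily τ) {g : ℤ} {n : ℕ} {x : ℤ} {a : Fin n → ℤ}
    (hx : x < 0) : ttau τ g (n + 1) (Fin.cons x a) = 0 := by
  refine ttau_eq_zero h ?_
  rintro ⟨h0, -, -⟩
  have := h0 0
  simp only [Fin.cons_zero] at this
  omega

variable (τ) in
/-- The weighted sum of all correlators `⟨τ̃_{a_1} ⋯ τ̃_{a_n}⟩_g`. -/
noncomputable def fullSum (M g : ℤ) (n : ℕ) : ℝ :=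
  ∑ a ∈ indexBox M n, tupleWeight a * ttau τ g n a

variable (τ) in
/-- The weighted sum of the correlators `⟨τ̃_x τ̃_{a_1} ⋯ τ̃_{a_n}⟩_g`, where `x` has weight one. -/
noncomputable def markedSum (M g : ℤ) (n : ℕ) : ℝ :=
  ∑ x ∈ Finset.Icc 0 M, ∑ a ∈ indexBox M n, tupleWeight a * ttau τ g (n + 1) (Fin.cons x a)

variable (τ) in
/-- The weighted sum of the correlators `⟨τ̃_x τ̃_{a_1} ⋯ τ̃_{a_n}⟩_g`, where `x` has
weight `x + 2`. -/
noncomputable def shiftedSum (M g : ℤ) (n : ℕ) : ℝ :=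
  ∑ x ∈ Finset.Icc 0 M, ((x : ℝ) + 2) *
    ∑ a ∈ indexBox M n, tupleWeight a * ttau τ g (n + 1) (Fin.cons x a)

variable (τ) in
/-- The weighted sum of the correlators `⟨τ̃_b τ̃_c τ̃_{a_1} ⋯ τ̃_{a_n}⟩_g`, where `b` and `c` have
weight one. -/
noncomputable def doublyMarkedSum (M g : ℤ) (n : ℕ) : ℝ :=
  ∑ b ∈ Finset.Icc 0 M, ∑ c ∈ Finset.Icc 0 M, ∑ a ∈ indexBox M n,
    tupleWeight a * ttau τ g (n + 2) (Fin.cons b (Fin.cons c a))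

theorem OmegaF_diagonal (h : DVVFamily τ) (g k : ℕ) (M : ℤ) (hM : 3 * (g : ℤ) + k ≤ M)
    (w : ℝ) (hw : 0 < w) :
    OmegaF τ g k (fun _ => w) =
      fullSum τ M g k * w ^ ((3 : ℝ) / 2 * (2 * g - 2 + k)) := by
  have hterm : ∀ a : Fin k → ℤ, (∀ i, 0 ≤ a i) →
      τ g k a * ∏ i, (dfac (2 * a i - 1) * w ^ ((a i : ℝ) + 1 / 2)) =
        tupleWeight a * ttau τ g k a * w ^ ((3 : ℝ) / 2 * (2 * g - 2 + k)) := by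
    intro a ha
    by_cases hs : ∑ i, a i = 3 * (g : ℤ) - 3 + k
    · rw [Finset.prod_mul_distrib, ← tupleWeight_mul_prod_dfac a ha,
        ← Real.rpow_sum_of_pos hw, ttau]
      have hs' : ∑ i, ((a i : ℝ) + 1 / 2) = (3 : ℝ) / 2 * (2 * g - 2 + k) := by
        rw [Finset.sum_add_distrib, ← Int.cast_sum, hs]
        simp
        ring
      rw [hs']
      ring
    · have h0 : τ g k a = 0 := h.vanish _ _ _ fun hc => hs hc.2.2
      simp [ttau, h0]
  rw [fullSum, Finset.sum_mul]
  unfold OmegaF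
  refine Finset.sum_of_injOn (fun a i => ((a i : ℕ) : ℤ)) ?_ ?_ ?_ ?_
  · intro a _ b _ hab
    ext i
    have := congrFun hab i
    simpa using this
  · intro a _
    rw [Finset.mem_coe, mem_indexBox]
    intro i
    have := (a i).isLt
    dsimp only
    omega
  · intro a ha hna
    rw [mem_indexBox] at ha
    rw [ttau_eq_zero h, mul_zero, zero_mul]
    rintro ⟨h0, -, h2⟩
    apply hna
    have hle : ∀ i, a i ≤ 3 * (g : ℤ) - 3 + k := fun i => by
      rw [← h2]
      exact Finset.single_le_sum (fun j _ => h0 j) (Finset.mem_univ i)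
    refine ⟨fun i => ⟨(a i).toNat, ?_⟩, by simp, ?_⟩
    · have := hle i
      have := h0 i
      omega
    · ext i
      simpa using h0 i
  · intro a _
    rw [← hterm _ fun i => by positivity]
    simp

theorem fullSum_succ (h : DVVFamily τ) (M g : ℤ) (n : ℕ) :
    (3 : ℝ) / 2 * (2 * g - 1 + n) * fullSum τ M g (n + 1) =
      ((n : ℝ) + 1) / 2 * markedSum τ M g n := by
  have hterm : ∀ a : Fin (n + 1) → ℤ,
      (3 : ℝ) / 2 * (2 * g - 1 + n) * (tupleWeight a * ttau τ g (n + 1) a) =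
        ∑ i, ((a i : ℝ) + 1 / 2) * (tupleWeight a * ttau τ g (n + 1) a) := by
    intro a
    rw [← Finset.sum_mul]
    by_cases hs : ∑ i, a i = 3 * (g : ℤ) - 3 + (n + 1 : ℕ)
    · congr 1
      rw [Finset.sum_add_distrib, ← Int.cast_sum, hs]
      simp
      ring
    · rw [ttau_eq_zero h fun hc => hs hc.2.2]
      simp
  rw [fullSum, Finset.mul_sum, Finset.sum_congr rfl fun a _ => hterm a,
    sum_sum_indexBox_of_swap, sum_indexBox_succ, markedSum, div_mul_eq_mul_div, mul_div_assoc,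
    Finset.sum_div]
  · congr 1
    refine Finset.sum_congr rfl fun x _ => ?_
    rw [Finset.sum_div]
    refine Finset.sum_congr rfl fun a _ => ?_
    have := mul_inv_cancel₀ (two_mul_cast_add_one_ne_zero x)
    rw [tupleWeight_cons, Fin.cons_zero]
    linear_combination (tupleWeight a * ttau τ g (n + 1) (Fin.cons x a) / 2) * this
  · intro i a
    rw [tupleWeight_comp_perm, ttau_comp_perm h]
    simp

theorem mul_markedSum (h : DVVFamily τ) (M g : ℤ) (n : ℕ) :
    (3 : ℝ) / 2 * (2 * g + n) * markedSum τ M g n =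
      shiftedSum τ M g n + ∑ x ∈ Finset.Icc 0 M, ∑ a ∈ indexBox M n,
        ∑ i, ((a i : ℝ) + 1 / 2) * (tupleWeight a * ttau τ g (n + 1) (Fin.cons x a)) := by
  rw [markedSum, shiftedSum, Finset.mul_sum, ← Finset.sum_add_distrib]
  refine Finset.sum_congr rfl fun x _ => ?_
  rw [Finset.mul_sum, Finset.mul_sum, ← Finset.sum_add_distrib]
  refine Finset.sum_congr rfl fun a _ => ?_
  rw [← Finset.sum_mul, ← add_mul]
  by_cases hs : x + ∑ i, a i = 3 * (g : ℤ) - 3 + (n + 1 : ℕ)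
  · congr 1
    have hx : ((x : ℝ) + ((∑ i, a i : ℤ) : ℝ)) = 3 * g - 3 + (n + 1) := by exact_mod_cast hs
    rw [Finset.sum_add_distrib, ← Int.cast_sum, Finset.sum_const, Finset.card_univ,
      Fintype.card_fin, nsmul_eq_mul]
    linarith
  · rw [ttau_eq_zero h fun hc => hs (by simpa [Fin.sum_univ_succ] using hc.2.2)]
    simp

theorem mul_markedSum_zero (h : DVVFamily τ) (M g : ℤ) :
    (3 : ℝ) / 2 * (2 * g) * markedSum τ M g 0 = shiftedSum τ M g 0 := by
  simpa using mul_markedSum h M g 0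

theorem mul_markedSum_succ (h : DVVFamily τ) (M g : ℤ) (n : ℕ) :
    (3 : ℝ) / 2 * (2 * g + (n + 1)) * markedSum τ M g (n + 1) =
      shiftedSum τ M g (n + 1) + ((n : ℝ) + 1) / 2 * doublyMarkedSum τ M g n := by
  have := mul_markedSum h M g (n + 1)
  push_cast at this
  rw [this, doublyMarkedSum, Finset.mul_sum]
  congr 1
  refine Finset.sum_congr rfl fun x _ => ?_
  rw [sum_sum_indexBox_of_swap, sum_indexBox_succ, div_mul_eq_mul_div, mul_div_assoc,
    Finset.sum_div]
  · congr 1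
    refine Finset.sum_congr rfl fun y _ => ?_
    rw [Finset.sum_div]
    refine Finset.sum_congr rfl fun a _ => ?_
    have := mul_inv_cancel₀ (two_mul_cast_add_one_ne_zero y)
    rw [tupleWeight_cons, Fin.cons_zero]
    linear_combination
      (tupleWeight a * ttau τ g (n + 2) (Fin.cons x (Fin.cons y a)) / 2) * this
  · intro i a
    rw [tupleWeight_comp_perm, ttau_cons_comp_perm h]
    simp

/-- The factor of an index `x` in a genus zero correlator of rescaled classes. -/
noncomputable def genusZeroFactor (x : ℤ) : ℝ := dfac (2 * x + 1) / (x.toNat.factorial : ℝ)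

theorem genusZeroFactor_succ (m : ℕ) :
    ((m : ℝ) + 1) * genusZeroFactor (m + 1) = (2 * m + 3) * genusZeroFactor m := by
  have h1 := dfac_two_mul_add_one ((m : ℤ) + 1) (by positivity)
  have h2 : (2 * ((m : ℤ) + 1) - 1) = 2 * m + 1 := by ring
  have h3 : ((m : ℤ) + 1).toNat = m + 1 := by omega
  have h4 : (m.factorial : ℝ) ≠ 0 := by positivity
  have h5 : ((m : ℝ) + 1) ≠ 0 := by positivity
  rw [h2] at h1
  rw [genusZeroFactor, genusZeroFactor, h1, h3, Int.toNat_natCast, Nat.factorial_succ]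
  push_cast
  field_simp
  ring

theorem genusZeroFactor_zero : genusZeroFactor 0 = 1 := by
  simp [genusZeroFactor, dfac]

theorem genusZeroFactor_one : genusZeroFactor 1 = 3 := by
  have := genusZeroFactor_succ 0
  simpa [genusZeroFactor_zero] using this

theorem genusZeroFactor_two : genusZeroFactor 2 = 15 / 2 := by
  have := genusZeroFactor_succ 1
  norm_num [genusZeroFactor_one] at this
  linarith

theorem mul_prod_genusZeroFactor_update {n : ℕ} (a : Fin n → ℤ) (i : Fin n) (v : ℤ) (r s : ℝ)
    (hv : r * genusZeroFactor v = s * genusZeroFactor (a i)) :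
    r * ∏ j, genusZeroFactor (Function.update a i v j) = s * ∏ j, genusZeroFactor (a j) := by
  have h1 : ∀ j, genusZeroFactor (Function.update a i v j) =
      Function.update (fun j => genusZeroFactor (a j)) i (genusZeroFactor v) j :=
    fun j => Function.apply_update (fun _ => genusZeroFactor) a i v j
  rw [Finset.prod_congr rfl fun j _ => h1 j, Finset.prod_update_of_mem (Finset.mem_univ i),
    ← Finset.prod_sdiff (Finset.singleton_subset_iff.mpr (Finset.mem_univ i)),
    Finset.prod_singleton, ← mul_assoc, hv]
  ring

theorem exists_comp_perm_eq_cons_zero {n : ℕ} (a : Fin (n + 1) → ℤ) (ha : ∀ i, 0 ≤ a i)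
    (hs : ∑ i, a i < n + 1) :
    ∃ (σ : Equiv.Perm (Fin (n + 1))) (b : Fin n → ℤ), a ∘ σ = Fin.cons 0 b := by
  obtain ⟨i, hi⟩ : ∃ i, a i = 0 := by
    by_contra! hne
    have : ∑ _i : Fin (n + 1), (1 : ℤ) ≤ ∑ i, a i :=
      Finset.sum_le_sum fun i _ => by
        have := ha i
        have := hne i
        omega
    simp at this
    omega
  refine ⟨Equiv.swap 0 i, Fin.tail (a ∘ Equiv.swap 0 i), ?_⟩
  have h0 : (a ∘ Equiv.swap 0 i) 0 = 0 := by simpa using hi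
  conv_lhs => rw [← Fin.cons_self_tail (a ∘ Equiv.swap 0 i), h0]

theorem ttau_cons_zero (h : DVVFamily τ) {g : ℤ} {n : ℕ} (hg : 0 ≤ g) (hn : 3 ≤ 2 * g + (n : ℤ))
    (a : Fin n → ℤ) (ha : ∀ i, 0 ≤ a i) :
    ttau τ g (n + 1) (Fin.cons 0 a) =
      ∑ i, (2 * (a i : ℝ) + 1) * ttau τ g n (Function.update a i (a i - 1)) := by
  rw [h.dvv g n hg hn 0 a le_rfl ha]
  simp

theorem ttau_genus_zero (h : DVVFamily τ) (n : ℕ) (a : Fin (n + 3) → ℤ) (ha : ∀ i, 0 ≤ a i)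
    (hs : ∑ i, a i = n) :
    ttau τ 0 (n + 3) a =
      ttau τ 0 3 (fun _ => 0) * (n.factorial : ℝ) * ∏ i, genusZeroFactor (a i) := by
  induction n with
  | zero =>
    have h0 : a = fun _ => 0 := by
      ext i
      have := Finset.single_le_sum (f := a) (fun j _ => ha j) (Finset.mem_univ i)
      have := ha i
      rw [hs] at *
      push_cast at *
      omega
    simp [h0, genusZeroFactor_zero]
  | succ n ih =>
    have hlt : ∑ i, a i < ((n + 3 : ℕ) : ℤ) + 1 := by
      rw [hs]
      push_cast
      omega
    obtain ⟨σ, b, hb⟩ := exists_comp_perm_eq_cons_zero a ha hlt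
    have hb0 : ∀ i, 0 ≤ b i := fun i => by
      have := ha (σ i.succ)
      have h2 := congrFun hb i.succ
      simp only [Function.comp_apply, Fin.cons_succ] at h2
      omega
    have hbs : ∑ i, b i = n + 1 := by
      have h1 : ∑ i, (a ∘ σ) i = ∑ i, a i := Equiv.sum_comp σ a
      rw [hb, Fin.sum_univ_succ] at h1
      simp only [Fin.cons_zero, Fin.cons_succ] at h1
      push_cast at hs
      omega
    have hprod : ∏ i, genusZeroFactor (a i) = ∏ i, genusZeroFactor (b i) := by
      rw [← Equiv.prod_comp σ]
      have : ∀ i, genusZeroFactor (a (σ i)) = genusZeroFactor ((Fin.cons 0 b : Fin _ → ℤ) i) :=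
        fun i => by rw [← hb, Function.comp_apply]
      rw [Finset.prod_congr rfl fun i _ => this i, Fin.prod_univ_succ]
      simp [genusZeroFactor_zero]
    rw [← ttau_comp_perm h 0 a σ, hb, hprod]
    rw [ttau_cons_zero h le_rfl (by push_cast; omega) b hb0]
    have hterm : ∀ i, (2 * (b i : ℝ) + 1) * ttau τ 0 (n + 3) (Function.update b i (b i - 1)) =
        (b i : ℝ) * (ttau τ 0 3 (fun _ => 0) * (n.factorial : ℝ) *
          ∏ i, genusZeroFactor (b i)) := by
      intro i
      by_cases hi : b i = 0
      · rw [hi, ttau_eq_zero h]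
        · simp
        · rintro ⟨h0, -, -⟩
          simpa using h0 i
      · have hi0 := hb0 i
        have hsum : ∑ j, Function.update b i (b i - 1) j = n := by
          rw [Finset.sum_update_of_mem (Finset.mem_univ i)]
          rw [← Finset.sum_sdiff (Finset.singleton_subset_iff.mpr (Finset.mem_univ i)),
            Finset.sum_singleton] at hbs
          omega
        have hnn : ∀ j, 0 ≤ Function.update b i (b i - 1) j := by
          intro j
          rcases eq_or_ne j i with rfl | hj
          · rw [Function.update_self]
            omega
          · rw [Function.update_of_ne hj]
            exact hb0 j
        rw [ih _ hnn hsum]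
        obtain ⟨k, hk⟩ : ∃ k : ℕ, b i = k + 1 := ⟨(b i - 1).toNat, by omega⟩
        have := mul_prod_genusZeroFactor_update b i (b i - 1) (2 * (b i : ℝ) + 1) (b i) (by
          have := genusZeroFactor_succ k
          rw [hk, add_sub_cancel_right]
          push_cast
          rw [this]
          ring)
        linear_combination ttau τ 0 3 (fun _ => 0) * (n.factorial : ℝ) * this
    rw [Finset.sum_congr rfl fun i _ => hterm i, ← Finset.sum_mul, ← Int.cast_sum, hbs,
      Nat.factorial_succ]
    push_cast
    ring

/-- Closed formula for genus zero correlators with an index set of arbitrary size. -/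
theorem ttau_genus_zero_of_card (h : DVVFamily τ) {n m : ℕ} (hn : n = m + 3) (a : Fin n → ℤ)
    (ha : ∀ i, 0 ≤ a i) (hs : ∑ i, a i = m) :
    ttau τ 0 n a =
      ttau τ 0 3 (fun _ => 0) * (m.factorial : ℝ) * ∏ i, genusZeroFactor (a i) := by
  subst hn
  exact ttau_genus_zero h m a ha hs

theorem ttau_cons_of_eq_zero {g : ℤ} {k : ℕ} (hk : k = 0) (x : ℤ) (a : Fin k → ℤ) :
    ttau τ g (k + 1) (Fin.cons x a) = ttau τ g 1 (fun _ => x) := by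
  subst hk
  congr 1
  ext i
  fin_cases i
  rfl

theorem ttau_cons_zero_of_eq_two {g : ℤ} {k : ℕ} (hk : k = 2) (x : ℤ) :
    ttau τ g (k + 1) (Fin.cons x fun _ => 0) = ttau τ g 3 (Fin.cons x fun _ => 0) := by
  subst hk
  rfl

theorem eight_mul_ttau_one_one (h : DVVFamily τ) :
    ttau τ 1 2 (Fin.cons 2 fun _ => 0) = 5 * ttau τ 1 1 (fun _ => 1) ∧
      8 * ttau τ 1 1 (fun _ => 1) = ttau τ 0 3 (fun _ => 0) := by
  have h1 := h.dvv 1 1 (by norm_num) (by norm_num) 2 (fun _ => 0) (by norm_num) (by simp)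
  have h2 := ttau_cons_zero h (g := 1) (n := 1) (by norm_num) (by norm_num) (fun _ => 2) (by simp)
  have h3 : ttau τ 1 2 (Fin.cons 0 fun _ => 2) = ttau τ 1 2 (Fin.cons 2 fun _ => 0) := by
    rw [← ttau_comp_perm h 1 _ (Equiv.swap 0 1)]
    congr 1
    ext i
    fin_cases i <;> rfl
  have h4 : ∀ (x y : ℤ) (i : Fin 1), Function.update (fun _ : Fin 1 => x) i y = fun _ => y := by
    intro x y i
    ext j
    rw [Subsingleton.elim j i, Function.update_self]
  have h5 : (Fin.cons 0 (Fin.cons 0 fun _ : Fin 1 => 0) : Fin 3 → ℤ) = fun _ => 0 := by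
    ext i
    fin_cases i <;> rfl
  have h6 : ∀ g₁ : ℤ, ∀ A : Finset (Fin 1),
      ¬(0 < 2 * g₁ - 1 + (A.card : ℤ) ∧ 0 < 2 * (1 - g₁) - 1 + ((Aᶜ).card : ℤ)) := by
    intro g₁ A
    have h7 := Finset.card_add_card_compl A
    rw [Fintype.card_fin] at h7
    omega
  simp only [h6, if_false, Finset.sum_const_zero] at h1
  norm_num [h4, h5] at h1
  norm_num [h4, h3] at h2
  exact ⟨h2, by linarith⟩

theorem sum_powerset_fin_two_left (x y : ℤ) :
    (∑ A ∈ (univ : Finset (Fin 2)).powerset,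
      if 0 < 2 * (0 : ℤ) - 1 + (A.card : ℤ) ∧ 0 < 2 * (1 - (0 : ℤ)) - 1 + ((Aᶜ).card : ℤ) then
        ttau τ 0 (A.card + 1) (Fin.cons x fun _ => 0) *
          ttau τ (1 - 0) ((Aᶜ).card + 1) (Fin.cons y fun _ => 0)
      else 0) = ttau τ 0 3 (Fin.cons x fun _ => 0) * ttau τ 1 1 (fun _ => y) := by
  rw [Finset.sum_eq_single univ]
  · rw [if_pos (by simp), ttau_cons_zero_of_eq_two (k := (univ : Finset (Fin 2)).card) (by simp),
      ttau_cons_of_eq_zero (k := (univ : Finset (Fin 2))ᶜ.card) (by simp), sub_zero]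
  · intro A _ hA
    have h1 := Finset.card_pos.mpr (Finset.nonempty_iff_ne_empty.mpr
      (mt (Finset.compl_eq_empty_iff A).mp hA))
    have h2 := Finset.card_add_card_compl A
    rw [Fintype.card_fin] at h2
    exact if_neg (by omega)
  · simp

theorem sum_powerset_fin_two_right (x y : ℤ) :
    (∑ A ∈ (univ : Finset (Fin 2)).powerset,
      if 0 < 2 * (1 : ℤ) - 1 + (A.card : ℤ) ∧ 0 < 2 * (1 - (1 : ℤ)) - 1 + ((Aᶜ).card : ℤ) then
        ttau τ 1 (A.card + 1) (Fin.cons x fun _ => 0) *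
          ttau τ (1 - 1) ((Aᶜ).card + 1) (Fin.cons y fun _ => 0)
      else 0) = ttau τ 1 1 (fun _ => x) * ttau τ 0 3 (Fin.cons y fun _ => 0) := by
  rw [Finset.sum_eq_single ∅]
  · rw [if_pos (by simp), ttau_cons_of_eq_zero (by simp), ttau_cons_zero_of_eq_two (by simp),
      sub_self]
  · intro A _ hA
    have h1 := Finset.card_pos.mpr (Finset.nonempty_iff_ne_empty.mpr hA)
    have h2 := Finset.card_add_card_compl A
    rw [Fintype.card_fin] at h2
    exact if_neg (by omega)
  · simp

theorem ttau_zero_three_sq (h : DVVFamily τ) :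
    ttau τ 0 3 (fun _ => 0) ^ 2 = ttau τ 0 3 (fun _ => 0) := by
  obtain ⟨e1, e2⟩ := eight_mul_ttau_one_one h
  have h1 := h.dvv 1 2 (by norm_num) (by norm_num) 3 (fun _ => 0) (by norm_num) (by simp)
  have hI : Finset.Icc (0 : ℤ) (3 - 2) = {0, 1} := by decide
  have hI' : Finset.Icc (0 : ℤ) 1 = {0, 1} := by decide
  simp only [hI, hI', Finset.sum_pair zero_ne_one] at h1
  rw [sum_powerset_fin_two_left, sum_powerset_fin_two_right, sum_powerset_fin_two_left,
    sum_powerset_fin_two_right] at h1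
  have k1 : (Fin.cons 0 fun _ : Fin 2 => 0 : Fin 3 → ℤ) = fun _ => 0 := by
    ext i
    fin_cases i <;> rfl
  have k2 : ttau τ 0 3 (Fin.cons 1 fun _ => 0) = 0 :=
    ttau_cons_eq_zero_of_lt h (by norm_num)
  have k3 : ttau τ 1 1 (fun _ => 0) = 0 := ttau_eq_zero h (by simp)
  have k4 : ttau τ 0 4 (Fin.cons 0 (Fin.cons 1 fun _ => 0)) = 3 * ttau τ 0 3 (fun _ => 0) := by
    rw [ttau_genus_zero_of_card h (n := 4) (m := 1) rfl]
    · simp [Fin.prod_univ_succ, genusZeroFactor_zero, genusZeroFactor_one]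
      ring
    · intro i
      fin_cases i <;> decide
    · simp [Fin.sum_univ_succ]
  have k5 : ttau τ 0 4 (Fin.cons 1 fun _ => 0) = 3 * ttau τ 0 3 (fun _ => 0) := by
    rw [ttau_genus_zero_of_card h (n := 4) (m := 1) rfl]
    · simp [Fin.prod_univ_succ, genusZeroFactor_zero, genusZeroFactor_one]
      ring
    · intro i
      fin_cases i <;> decide
    · simp [Fin.sum_univ_succ]
  have k6 : ttau τ 1 3 (Fin.cons 3 fun _ => 0) = 35 * ttau τ 1 1 (fun _ => 1) := by
    have p1 : ttau τ 1 3 (Fin.cons 3 fun _ => 0) =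
        ttau τ 1 3 (Fin.cons 0 (Fin.cons 3 fun _ => 0)) := by
      rw [← ttau_comp_perm h 1 _ (Equiv.swap 0 1)]
      congr 1
      ext i
      fin_cases i <;> rfl
    have p2 : Function.update (Fin.cons 3 fun _ => 0 : Fin 2 → ℤ) 0 2 = Fin.cons 2 fun _ => 0 := by
      simp
    have p3 : ttau τ 1 2 (Function.update (Fin.cons 3 fun _ => 0 : Fin 2 → ℤ) 1 (-1)) = 0 := by
      refine ttau_eq_zero h ?_
      rintro ⟨h0, -, -⟩
      simpa using h0 1
    rw [p1, ttau_cons_zero h (n := 2) (by norm_num) (by norm_num)]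
    · rw [Fin.sum_univ_two]
      simp only [Fin.cons_zero, Fin.cons_one]
      norm_num
      rw [p3, e1]
      ring
    · intro i
      fin_cases i <;> decide
  have k7 : ∀ i : Fin 2, ttau τ 1 2 (Function.update (fun _ => 0) i 2) =
      5 * ttau τ 1 1 (fun _ => 1) := by
    intro i
    rw [← e1, ← ttau_comp_perm h 1 _ (Equiv.swap 0 i)]
    congr 1
    ext j
    fin_cases i <;> fin_cases j <;> rfl
  norm_num [k1, k2, k3, k4, k5, k6, k7] at h1
  rw [← e2]
  rw [← e2] at h1
  linarith

theorem ttau_neg_one_cons_zero_zero (h : DVVFamily τ) {n : ℕ} (m : Fin n → ℕ)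
    (hm : ∑ i, m i + 4 = n) :
    ttau τ (-1) (n + 2) (Fin.cons 0 (Fin.cons 0 fun i => (m i : ℤ))) = 0 := by
  set c := ttau τ 0 3 (fun _ => 0) with hc
  set P := ∏ i, genusZeroFactor (m i) with hP
  have hmZ : ∑ i, (m i : ℤ) + 4 = n := by exact_mod_cast hm
  obtain ⟨k, hk⟩ : ∃ k, n = k + 3 := ⟨n - 3, by omega⟩
  have h1 := h.dvv 0 n le_rfl (by omega) 2 (fun i => (m i : ℤ)) (by norm_num) (by simp)
  have hA : ttau τ 0 (n + 1) (Fin.cons 2 fun i => (m i : ℤ)) =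
      c * ((k + 1).factorial : ℝ) * (15 / 2 * P) := by
    rw [ttau_genus_zero_of_card h (m := k + 1) (by omega), Fin.prod_univ_succ]
    · simp only [Fin.cons_zero, Fin.cons_succ, genusZeroFactor_two, ← hP, ← hc]
    · intro i
      refine Fin.cases ?_ (fun j => ?_) i <;> simp
    · rw [Fin.sum_univ_succ]
      simp only [Fin.cons_zero, Fin.cons_succ]
      omega
  have hL : ∀ i, (2 * (((m i : ℕ) : ℤ) : ℝ) + 1) *
      ttau τ 0 n (Function.update (fun i => (m i : ℤ)) i (2 + (m i : ℤ) - 1)) =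
        c * (k.factorial : ℝ) * P * (4 * (m i + 1) - ((m i : ℝ) + 1)⁻¹) := by
    intro i
    have hpos : (m i : ℝ) + 1 ≠ 0 := by positivity
    rw [show (2 + (m i : ℤ) - 1) = m i + 1 by ring, ttau_genus_zero_of_card h (m := k) hk]
    · have := mul_prod_genusZeroFactor_update (fun i => (m i : ℤ)) i (m i + 1) 1
        ((2 * m i + 3) / (m i + 1)) (by
          have := genusZeroFactor_succ (m i)
          field_simp
          linarith)
      rw [one_mul] at this
      rw [this]
      push_cast
      field_simp
      ring
    · intro j
      rcases eq_or_ne j i with rfl | hj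
      · rw [Function.update_self]
        positivity
      · rw [Function.update_of_ne hj]
        positivity
    · rw [Finset.sum_update_of_mem (Finset.mem_univ i)]
      rw [← Finset.sum_sdiff (Finset.singleton_subset_iff.mpr (Finset.mem_univ i)),
        Finset.sum_singleton] at hmZ
      omega
  have hfactor : ∀ A : Finset (Fin n), 2 ≤ A.card →
      ttau τ 0 (A.card + 1) (Fin.cons 0 fun j => (m (A.orderIsoOfFin rfl j).1 : ℤ)) =
        if ∑ i ∈ A, m i + 2 = A.card then
          c * ((A.card - 2).factorial : ℝ) * ∏ i ∈ A, genusZeroFactor (m i) else 0 := by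
    intro A hA
    have hsum : ∑ j, (m (A.orderIsoOfFin rfl j).1 : ℤ) = ∑ i ∈ A, (m i : ℤ) := by
      rw [← Finset.sum_coe_sort A]
      exact Equiv.sum_comp (A.orderIsoOfFin rfl).toEquiv fun i => (m i.1 : ℤ)
    have hprod : ∏ j, genusZeroFactor (m (A.orderIsoOfFin rfl j).1) =
        ∏ i ∈ A, genusZeroFactor (m i) := by
      rw [← Finset.prod_coe_sort A]
      exact Equiv.prod_comp (A.orderIsoOfFin rfl).toEquiv fun i => genusZeroFactor (m i.1)
    have hcast : ((∑ i ∈ A, m i : ℕ) : ℤ) = ∑ i ∈ A, (m i : ℤ) := by push_cast; rfl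
    split_ifs with hs
    · rw [ttau_genus_zero_of_card h (m := A.card - 2) (by omega), Fin.prod_univ_succ]
      · simp only [Fin.cons_zero, Fin.cons_succ, genusZeroFactor_zero, one_mul, hprod]
        rw [hc]
      · intro i
        refine Fin.cases ?_ (fun j => ?_) i <;> simp
      · rw [Fin.sum_univ_succ]
        simp only [Fin.cons_zero, Fin.cons_succ, hsum]
        omega
    · refine ttau_eq_zero h ?_
      rintro ⟨-, -, h2⟩
      rw [Fin.sum_univ_succ] at h2
      simp only [Fin.cons_zero, Fin.cons_succ, hsum] at h2
      push_cast at h2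
      omega
  have hQ : ∀ A : Finset (Fin n),
      (if 0 < 2 * (0 : ℤ) - 1 + (A.card : ℤ) ∧ 0 < 2 * (0 - (0 : ℤ)) - 1 + ((Aᶜ).card : ℤ) then
        ttau τ 0 (A.card + 1) (Fin.cons 0 fun j => (m (A.orderIsoOfFin rfl j).1 : ℤ)) *
          ttau τ (0 - 0) ((Aᶜ).card + 1)
            (Fin.cons (2 - 2 - 0) fun j => (m ((Aᶜ).orderIsoOfFin rfl j).1 : ℤ))
      else 0) = c ^ 2 * P * splitTerm univ m A := by
    intro A
    have hcard := Finset.card_add_card_compl A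
    have hsumc := Finset.sum_add_sum_compl A m
    have hprodc := Finset.prod_mul_prod_compl A fun i => genusZeroFactor (m i)
    rw [Fintype.card_fin] at hcard
    rw [splitTerm, Finset.card_univ, Fintype.card_fin]
    by_cases hs : ∑ i ∈ A, m i + 2 = A.card
    · have hs' : ∑ i ∈ Aᶜ, m i + 2 = (Aᶜ).card := by omega
      rw [if_pos (by omega), if_pos hs, sub_zero, sub_self, sub_zero, hfactor A (by omega),
        hfactor Aᶜ (by omega), if_pos hs, if_pos hs', hP, ← hprodc,
        show n - A.card - 2 = (Aᶜ).card - 2 by omega]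
      ring
    · rw [if_neg hs]
      split_ifs with hst
      · rw [hfactor A (by omega), if_neg hs, zero_mul, mul_zero]
      · rw [mul_zero]
  have hI : Finset.Icc (0 : ℤ) (2 - 2) = {0} := by decide
  have hI' : Finset.Icc (0 : ℤ) 0 = {0} := by decide
  have hcc : c ^ 2 = c := ttau_zero_three_sq h
  have hk' : n - 3 = k := by omega
  rw [hI, hI', Finset.sum_singleton, Finset.sum_singleton, hA,
    Finset.sum_congr rfl fun i _ => hL i, Finset.sum_congr rfl fun A _ => hQ A,
    ← Finset.mul_sum, ← Finset.mul_sum, sum_splitTerm univ m (by simpa using hm), hcc,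
    Finset.sum_sub_distrib, ← Finset.mul_sum, Finset.sum_add_distrib,
    Finset.sum_const, Finset.card_univ, Fintype.card_fin, hk', Nat.factorial_succ] at h1
  have hnR : (n : ℝ) = k + 3 := by exact_mod_cast hk
  have hmR : ∑ i, (m i : ℝ) = (k : ℝ) - 1 := by
    have : ∑ i, (m i : ℝ) + 4 = n := by exact_mod_cast hm
    linarith
  rw [hmR, nsmul_eq_mul, hnR, show (0 : ℤ) - 1 = -1 by rfl, show (2 : ℤ) - 2 - 0 = 0 by rfl] at h1
  push_cast at h1
  linear_combination -2 * h1

theorem ttau_neg_one (h : DVVFamily τ) (n : ℕ) (a : Fin n → ℤ) : ttau τ (-1) n a = 0 := by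
  by_contra hne
  obtain ⟨h0, -, hs⟩ := not_not.mp (mt (ttau_eq_zero h) hne)
  have hnonneg : 0 ≤ ∑ i, a i := Finset.sum_nonneg fun i _ => h0 i
  obtain ⟨k, rfl⟩ : ∃ k, n = k + 2 := ⟨n - 2, by omega⟩
  obtain ⟨σ, b, hb⟩ := exists_comp_perm_eq_cons_zero (n := k + 1) a h0 (by
    push_cast at hs ⊢
    linarith)
  have hb0 : ∀ i, 0 ≤ b i := fun i => by
    have := h0 (σ i.succ)
    have h2 := congrFun hb i.succ
    simp only [Function.comp_apply, Fin.cons_succ] at h2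
    omega
  have hbs : ∑ i, b i = ∑ i, a i := by
    rw [← Equiv.sum_comp σ a]
    have : ∀ i, a (σ i) = (Fin.cons 0 b : Fin _ → ℤ) i := fun i => by
      rw [← hb, Function.comp_apply]
    rw [Finset.sum_congr rfl fun i _ => this i, Fin.sum_cons, zero_add]
  obtain ⟨ρ, d, hd⟩ := exists_comp_perm_eq_cons_zero b hb0 (by
    push_cast at hs
    linarith)
  have hd0 : ∀ i, 0 ≤ d i := fun i => by
    have := hb0 (ρ i.succ)
    have h2 := congrFun hd i.succ
    simp only [Function.comp_apply, Fin.cons_succ] at h2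
    omega
  have hds : ∑ i, d i = ∑ i, b i := by
    rw [← Equiv.sum_comp ρ b]
    have : ∀ i, b (ρ i) = (Fin.cons 0 d : Fin _ → ℤ) i := fun i => by
      rw [← hd, Function.comp_apply]
    rw [Finset.sum_congr rfl fun i _ => this i, Fin.sum_cons, zero_add]
  apply hne
  rw [← ttau_comp_perm h _ a σ, hb, ← ttau_cons_comp_perm h _ 0 b ρ, hd]
  have hdm : d = fun i => ((d i).toNat : ℤ) := by
    ext i
    have := hd0 i
    omega
  rw [hdm]
  refine ttau_neg_one_cons_zero_zero h _ ?_
  have : ((∑ i, (d i).toNat : ℕ) : ℤ) = ∑ i, d i := by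
    push_cast
    exact Finset.sum_congr rfl fun i _ => by
      have := hd0 i
      omega
  push_cast at hs
  omega

theorem sum_update_eq_mul_shiftedSum (h : DVVFamily τ) (M g : ℤ) (n : ℕ)
    (hM : 3 * g + n ≤ M) :
    ∑ x ∈ Finset.Icc 0 M, ∑ a ∈ indexBox M n, tupleWeight a *
      ∑ i, (2 * (a i : ℝ) + 1) * ttau τ g n (Function.update a i (x + a i - 1)) =
      n * shiftedSum τ M g (n - 1) := by
  cases n with
  | zero => simp
  | succ k =>
    have hx : ∀ x : ℤ, ∑ a ∈ indexBox M (k + 1), tupleWeight a *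
        ∑ i, (2 * (a i : ℝ) + 1) * ttau τ g (k + 1) (Function.update a i (x + a i - 1)) =
        ((k : ℝ) + 1) * ∑ y ∈ Finset.Icc 0 M, ∑ a ∈ indexBox M k,
          tupleWeight a * ttau τ g (k + 1) (Fin.cons (x + y - 1) a) := by
      intro x
      simp_rw [Finset.mul_sum]
      rw [sum_sum_indexBox_of_swap, sum_indexBox_succ, Finset.mul_sum]
      · refine Finset.sum_congr rfl fun y _ => ?_
        rw [Finset.mul_sum]
        refine Finset.sum_congr rfl fun a _ => ?_
        have := inv_mul_cancel₀ (two_mul_cast_add_one_ne_zero y)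
        rw [tupleWeight_cons, Fin.cons_zero, Fin.update_cons_zero]
        linear_combination ((k : ℝ) + 1) *
          (tupleWeight a * ttau τ g (k + 1) (Fin.cons (x + y - 1) a)) * this
      · intro i a
        rw [tupleWeight_comp_perm, Function.comp_apply, Equiv.swap_apply_right,
          ← ttau_comp_perm h g (Function.update a 0 (x + a 0 - 1)) (Equiv.swap 0 i),
          Function.update_comp_equiv, Equiv.symm_swap, Equiv.swap_apply_left]
    rw [Finset.sum_congr rfl fun x _ => hx x, ← Finset.mul_sum,
      sum_Icc_sum_Icc_add_sub_one M fun m => ∑ a ∈ indexBox M k,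
        tupleWeight a * ttau τ g (k + 1) (Fin.cons m a)]
    · simp [shiftedSum]
    · intro m hm
      exact Finset.sum_eq_zero fun a _ => by rw [ttau_cons_eq_zero_of_neg h hm, mul_zero]
    · intro m hm
      push_cast at hM
      exact Finset.sum_eq_zero fun a _ => by
        rw [ttau_cons_eq_zero_of_lt h (by omega), mul_zero]

theorem sum_markedSum_mul_markedSum (M g g' : ℤ) {n : ℕ} (A : Finset (Fin n)) :
    ∑ b ∈ Finset.Icc 0 M, ∑ c ∈ Finset.Icc 0 M, ∑ a ∈ indexBox M n, tupleWeight a *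
      (ttau τ g (A.card + 1) (Fin.cons b (fun j => a (A.orderIsoOfFin rfl j).1)) *
        ttau τ g' ((Aᶜ).card + 1) (Fin.cons c (fun j => a ((Aᶜ).orderIsoOfFin rfl j).1))) =
      markedSum τ M g A.card * markedSum τ M g' (Aᶜ).card := by
  rw [markedSum, markedSum, Finset.sum_mul_sum]
  refine Finset.sum_congr rfl fun b _ => Finset.sum_congr rfl fun c _ => ?_
  exact sum_indexBox_split M A (fun a => ttau τ g (A.card + 1) (Fin.cons b a))
    fun a => ttau τ g' ((Aᶜ).card + 1) (Fin.cons c a)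

theorem markedSum_eq (h : DVVFamily τ) (M g : ℤ) (n : ℕ) (hg : 0 ≤ g) (hn : 3 ≤ 2 * g + (n : ℤ))
    (hM : 3 * g + n ≤ M) :
    markedSum τ M g n = n * shiftedSum τ M g (n - 1) + 1 / 2 * (doublyMarkedSum τ M (g - 1) n +
      ∑ g₁ ∈ Finset.Icc (0 : ℤ) g, ∑ A ∈ (univ : Finset (Fin n)).powerset,
        if 0 < 2 * g₁ - 1 + (A.card : ℤ) ∧ 0 < 2 * (g - g₁) - 1 + ((Aᶜ).card : ℤ) then
          markedSum τ M g₁ A.card * markedSum τ M (g - g₁) (Aᶜ).card else 0) := by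
  set G : ℤ → ℤ → ℝ := fun b c => ∑ a ∈ indexBox M n, tupleWeight a *
    (ttau τ (g - 1) (n + 2) (Fin.cons b (Fin.cons c a)) +
      ∑ g₁ ∈ Finset.Icc (0 : ℤ) g, ∑ A ∈ (univ : Finset (Fin n)).powerset,
        if 0 < 2 * g₁ - 1 + (A.card : ℤ) ∧ 0 < 2 * (g - g₁) - 1 + ((Aᶜ).card : ℤ) then
          ttau τ g₁ (A.card + 1) (Fin.cons b (fun j => a (A.orderIsoOfFin rfl j).1)) *
            ttau τ (g - g₁) ((Aᶜ).card + 1)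
              (Fin.cons c (fun j => a ((Aᶜ).orderIsoOfFin rfl j).1))
        else 0) with hG
  have hterm : ∀ x ∈ Finset.Icc 0 M, ∑ a ∈ indexBox M n,
      tupleWeight a * ttau τ g (n + 1) (Fin.cons x a) =
      (∑ a ∈ indexBox M n, tupleWeight a *
        ∑ i, (2 * (a i : ℝ) + 1) * ttau τ g n (Function.update a i (x + a i - 1))) +
      1 / 2 * ∑ b ∈ Finset.Icc 0 (x - 2), G b (x - 2 - b) := by
    intro x hx
    rw [hG, Finset.sum_comm, Finset.mul_sum, ← Finset.sum_add_distrib]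
    refine Finset.sum_congr rfl fun a ha => ?_
    rw [h.dvv g n hg hn x a (Finset.mem_Icc.mp hx).1
      fun i => (mem_indexBox.mp ha i).1, ← Finset.mul_sum]
    ring
  rw [markedSum, Finset.sum_congr rfl hterm, Finset.sum_add_distrib,
    sum_update_eq_mul_shiftedSum h M g n hM, ← Finset.mul_sum, sum_Icc_sum_Icc_sub_two M G]
  · congr 2
    simp only [hG, mul_add, Finset.sum_add_distrib]
    rw [doublyMarkedSum]
    congr 1
    simp_rw [Finset.mul_sum]
    have h1 : ∀ b c : ℤ, ∑ a ∈ indexBox M n, ∑ g₁ ∈ Finset.Icc (0 : ℤ) g,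
        ∑ A ∈ (univ : Finset (Fin n)).powerset, tupleWeight a *
        (if 0 < 2 * g₁ - 1 + (A.card : ℤ) ∧ 0 < 2 * (g - g₁) - 1 + ((Aᶜ).card : ℤ) then
          ttau τ g₁ (A.card + 1) (Fin.cons b (fun j => a (A.orderIsoOfFin rfl j).1)) *
            ttau τ (g - g₁) ((Aᶜ).card + 1)
              (Fin.cons c (fun j => a ((Aᶜ).orderIsoOfFin rfl j).1))
        else 0) = ∑ g₁ ∈ Finset.Icc (0 : ℤ) g, ∑ A ∈ (univ : Finset (Fin n)).powerset,
          ∑ a ∈ indexBox M n, tupleWeight a *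
        (if 0 < 2 * g₁ - 1 + (A.card : ℤ) ∧ 0 < 2 * (g - g₁) - 1 + ((Aᶜ).card : ℤ) then
          ttau τ g₁ (A.card + 1) (Fin.cons b (fun j => a (A.orderIsoOfFin rfl j).1)) *
            ttau τ (g - g₁) ((Aᶜ).card + 1)
              (Fin.cons c (fun j => a ((Aᶜ).orderIsoOfFin rfl j).1))
        else 0) := by
      intro b c
      rw [Finset.sum_comm]
      exact Finset.sum_congr rfl fun g₁ _ => Finset.sum_comm
    rw [Finset.sum_congr rfl fun b _ => Finset.sum_congr rfl fun c _ => h1 b c,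
      Finset.sum_congr rfl fun b _ => Finset.sum_comm, Finset.sum_comm]
    refine Finset.sum_congr rfl fun g₁ _ => ?_
    rw [Finset.sum_congr rfl fun b _ => Finset.sum_comm, Finset.sum_comm]
    refine Finset.sum_congr rfl fun A _ => ?_
    split_ifs
    · exact sum_markedSum_mul_markedSum M g₁ (g - g₁) A
    · simp
  · intro b c hbc
    rw [hG]
    refine Finset.sum_eq_zero fun a ha => ?_
    have h0 : 0 ≤ ∑ i, a i :=
      Finset.sum_nonneg fun i _ => (mem_indexBox.mp ha i).1
    rw [ttau_eq_zero h, zero_add, Finset.sum_eq_zero, mul_zero]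
    · intro g₁ _
      refine Finset.sum_eq_zero fun A _ => ?_
      have hcard := Finset.card_add_card_compl A
      rw [Fintype.card_fin] at hcard
      rcases lt_or_ge (3 * g₁ - 2 + (A.card : ℤ)) b with hb | hb
      · rw [ttau_cons_eq_zero_of_lt h hb, zero_mul, ite_self]
      · rw [ttau_cons_eq_zero_of_lt h (g := g - g₁) (by omega), mul_zero, ite_self]
    · rintro ⟨-, -, h2⟩
      rw [Fin.sum_cons, Fin.sum_cons] at h2
      push_cast at h2
      omega

theorem doublyMarkedSum_neg_one (h : DVVFamily τ) (M : ℤ) (n : ℕ) :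
    doublyMarkedSum τ M (-1) n = 0 := by
  simp [doublyMarkedSum, ttau_neg_one h]

theorem markedSum_eq_sum_range (h : DVVFamily τ) (M g : ℤ) (n : ℕ) (hg : 0 ≤ g)
    (hn : 3 ≤ 2 * g + (n : ℤ)) (hM : 3 * g + n ≤ M) :
    markedSum τ M g n = n * shiftedSum τ M g (n - 1) + 1 / 2 * (doublyMarkedSum τ M (g - 1) n +
      ∑ g₁ ∈ Finset.Icc (0 : ℤ) g, ∑ k ∈ Finset.range (n + 1),
        if 0 < 2 * g₁ - 1 + (k : ℤ) ∧ 0 < 2 * (g - g₁) - 1 + ((n - k : ℕ) : ℤ) then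
          (n.choose k : ℝ) * (markedSum τ M g₁ k * markedSum τ M (g - g₁) (n - k)) else 0) := by
  rw [markedSum_eq h M g n hg hn hM]
  congr 3
  refine Finset.sum_congr rfl fun g₁ _ => ?_
  have := Finset.sum_powerset_apply_card (x := (univ : Finset (Fin n))) (fun k =>
    if 0 < 2 * g₁ - 1 + (k : ℤ) ∧ 0 < 2 * (g - g₁) - 1 + ((n - k : ℕ) : ℤ) then
      markedSum τ M g₁ k * markedSum τ M (g - g₁) (n - k) else 0)
  simp only [Finset.card_univ, Fintype.card_fin, nsmul_eq_mul, mul_ite, mul_zero] at this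
  rw [← this]
  refine Finset.sum_congr rfl fun A _ => ?_
  rw [Finset.card_compl, Fintype.card_fin]

/-- The pairs `(g, n)` with `2 * g + n = N`. -/
def levelPairs (N : ℕ) : Finset (ℕ × ℕ) :=
  {p ∈ Finset.range (N + 1) ×ˢ Finset.range (N + 1) | 2 * p.1 + p.2 = N}

theorem mem_levelPairs {N : ℕ} {p : ℕ × ℕ} : p ∈ levelPairs N ↔ 2 * p.1 + p.2 = N := by
  simp only [levelPairs, Finset.mem_filter, Finset.mem_product, Finset.mem_range]
  omega

theorem sum_levelPairs (N : ℕ) (F : ℕ → ℕ → ℝ) :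
    ∑ p ∈ levelPairs N, F p.1 p.2 =
      ∑ g ∈ Finset.range (N + 1), if 2 * g ≤ N then F g (N - 2 * g) else 0 := by
  rw [← Finset.sum_filter]
  refine Finset.sum_nbij' (fun p => p.1) (fun g => (g, N - 2 * g)) ?_ ?_ ?_ ?_ ?_
  · rintro ⟨g, n⟩ hp
    rw [mem_levelPairs] at hp
    simp only [Finset.mem_filter, Finset.mem_range]
    dsimp only at hp
    omega
  · intro g hg
    simp only [Finset.mem_filter, Finset.mem_range] at hg
    rw [mem_levelPairs]
    dsimp only
    omega
  · rintro ⟨g, n⟩ hp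
    rw [mem_levelPairs] at hp
    dsimp only at hp ⊢
    congr 1
    omega
  · intro g _
    rfl
  · rintro ⟨g, n⟩ hp
    rw [mem_levelPairs] at hp
    dsimp only at hp ⊢
    congr 1
    omega

theorem sum_levelPairs_pred_right (N : ℕ) (F : ℕ → ℕ → ℝ) :
    ∑ p ∈ levelPairs (N + 1), (if 1 ≤ p.2 then F p.1 (p.2 - 1) else 0) =
      ∑ p ∈ levelPairs N, F p.1 p.2 := by
  rw [← Finset.sum_filter]
  refine Finset.sum_nbij' (fun p => (p.1, p.2 - 1)) (fun p => (p.1, p.2 + 1)) ?_ ?_ ?_ ?_ ?_ <;>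
    rintro ⟨g, n⟩ hp <;> simp only [Finset.mem_filter, mem_levelPairs, Prod.mk.injEq] at hp ⊢ <;>
    first | omega | (simp only [true_and]; omega)

theorem sum_levelPairs_pred_left (N : ℕ) (F : ℕ → ℕ → ℝ) :
    ∑ p ∈ levelPairs (N + 2), (if 1 ≤ p.1 then F (p.1 - 1) p.2 else 0) =
      ∑ p ∈ levelPairs N, F p.1 p.2 := by
  rw [← Finset.sum_filter]
  refine Finset.sum_nbij' (fun p => (p.1 - 1, p.2)) (fun p => (p.1 + 1, p.2)) ?_ ?_ ?_ ?_ ?_ <;>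
    rintro ⟨g, n⟩ hp <;> simp only [Finset.mem_filter, mem_levelPairs, Prod.mk.injEq] at hp ⊢ <;>
    first | omega | (simp only [and_true]; omega)

theorem sum_levelPairs_split (N : ℕ) (F : ℕ → ℕ → ℝ) :
    ∑ p ∈ levelPairs N, ∑ g ∈ Finset.range (p.1 + 1), ∑ k ∈ Finset.range (p.2 + 1),
      (if 2 ≤ 2 * g + k ∧ 2 ≤ 2 * (p.1 - g) + (p.2 - k) then
        F g k * F (p.1 - g) (p.2 - k) else 0) =
      ∑ i ∈ Finset.range (N + 1), if 2 ≤ i ∧ 2 ≤ N - i then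
        (∑ p ∈ levelPairs i, F p.1 p.2) * ∑ p ∈ levelPairs (N - i), F p.1 p.2 else 0 := by
  have hr : ∀ i, (if 2 ≤ i ∧ 2 ≤ N - i then
      (∑ p ∈ levelPairs i, F p.1 p.2) * ∑ p ∈ levelPairs (N - i), F p.1 p.2 else 0) =
      ∑ q ∈ levelPairs i ×ˢ levelPairs (N - i),
        if 2 ≤ i ∧ 2 ≤ N - i then F q.1.1 q.1.2 * F q.2.1 q.2.2 else 0 := by
    intro i
    split_ifs
    · rw [Finset.sum_mul_sum, Finset.sum_product]
    · simp
  simp_rw [← Finset.sum_product']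
  rw [Finset.sum_congr rfl fun i _ => hr i, Finset.sum_sigma', Finset.sum_sigma']
  refine Finset.sum_nbij'
    (fun x => ⟨2 * x.2.1 + x.2.2, (x.2, (x.1.1 - x.2.1, x.1.2 - x.2.2))⟩)
    (fun y => ⟨(y.2.1.1 + y.2.2.1, y.2.1.2 + y.2.2.2), y.2.1⟩) ?_ ?_ ?_ ?_ ?_
  · rintro ⟨⟨g, n⟩, ⟨g₁, k⟩⟩ hx
    simp only [Finset.mem_sigma, mem_levelPairs, Finset.mem_product, Finset.mem_range] at hx ⊢
    simp only [true_and]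
    omega
  · rintro ⟨i, ⟨⟨g₁, k₁⟩, ⟨g₂, k₂⟩⟩⟩ hy
    simp only [Finset.mem_sigma, mem_levelPairs, Finset.mem_product, Finset.mem_range] at hy ⊢
    omega
  · rintro ⟨⟨g, n⟩, ⟨g₁, k⟩⟩ hx
    simp only [Finset.mem_sigma, mem_levelPairs, Finset.mem_product, Finset.mem_range] at hx
    obtain ⟨-, h1, h2⟩ := hx
    simp only [Sigma.mk.injEq, Prod.mk.injEq, heq_eq_eq, and_true]
    omega
  · rintro ⟨i, ⟨⟨g₁, k₁⟩, ⟨g₂, k₂⟩⟩⟩ hy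
    simp only [Finset.mem_sigma, mem_levelPairs, Finset.mem_product, Finset.mem_range] at hy
    obtain ⟨-, rfl, h2⟩ := hy
    simp
  · rintro ⟨⟨g, n⟩, ⟨g₁, k⟩⟩ hx
    simp only [Finset.mem_sigma, mem_levelPairs, Finset.mem_product, Finset.mem_range] at hx
    have hN : N - (2 * g₁ + k) = 2 * (g - g₁) + (n - k) := by omega
    simp only [hN]

variable (τ) in
/-- The marked sum normalised by the symmetries of the unmarked points. -/
noncomputable def normMarkedSum (M : ℤ) (g n : ℕ) : ℝ :=
  markedSum τ M g n / (2 * n.factorial)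

variable (τ) in
/-- The sum of the normalised marked sums over all `(g, n)` with `2 * g + n = N`. -/
noncomputable def levelSum (M : ℤ) (N : ℕ) : ℝ :=
  ∑ p ∈ levelPairs N, normMarkedSum τ M p.1 p.2

theorem normMarkedSum_eq (h : DVVFamily τ) (M : ℤ) (g n : ℕ) (hn : 3 ≤ 2 * g + n)
    (hM : 3 * (g : ℤ) + n ≤ M) :
    normMarkedSum τ M g n =
      (if 1 ≤ n then shiftedSum τ M g (n - 1) / (2 * (n - 1).factorial) else 0) +
      (if 1 ≤ g then doublyMarkedSum τ M (g - 1 : ℕ) n / (4 * n.factorial) else 0) +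
      ∑ g₁ ∈ Finset.range (g + 1), ∑ k ∈ Finset.range (n + 1),
        if 2 ≤ 2 * g₁ + k ∧ 2 ≤ 2 * (g - g₁) + (n - k) then
          normMarkedSum τ M g₁ k * normMarkedSum τ M (g - g₁ : ℕ) (n - k) else 0 := by
  rw [normMarkedSum, markedSum_eq_sum_range h M g n (by positivity) (by omega) hM, mul_add,
    ← add_assoc, add_div, add_div]
  congr 1
  · congr 1
    · cases n with
      | zero => simp
      | succ m =>
        rw [if_pos (by omega), Nat.factorial_succ, Nat.add_sub_cancel]
        push_cast
        field_simp
    · cases g with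
      | zero => simp [doublyMarkedSum_neg_one h]
      | succ m =>
        rw [if_pos (by omega), Nat.add_sub_cancel]
        push_cast
        rw [add_sub_cancel_right]
        field_simp
        ring
  · rw [Finset.mul_sum, Finset.sum_div]
    symm
    refine Finset.sum_nbij' (fun i : ℕ => (i : ℤ)) Int.toNat ?_ ?_ ?_ ?_ ?_
    · intro i hi
      rw [Finset.mem_range] at hi
      rw [Finset.mem_Icc]
      omega
    · intro i hi
      rw [Finset.mem_Icc] at hi
      rw [Finset.mem_range]
      omega
    · intro i _
      simp
    · intro i hi
      rw [Finset.mem_Icc] at hi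
      omega
    · intro g₁ hg₁
      rw [Finset.mem_range] at hg₁
      rw [Finset.mul_sum, Finset.sum_div]
      refine Finset.sum_congr rfl fun k hk => ?_
      rw [Finset.mem_range] at hk
      by_cases hc : 2 ≤ 2 * g₁ + k ∧ 2 ≤ 2 * (g - g₁) + (n - k)
      · have hch := Nat.choose_mul_factorial_mul_factorial (show k ≤ n by omega)
        have hch' : (n.choose k : ℝ) * k.factorial * (n - k).factorial = n.factorial := by
          exact_mod_cast hch
        have h1 : (k.factorial : ℝ) ≠ 0 := by positivity
        have h2 : ((n - k).factorial : ℝ) ≠ 0 := by positivity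
        have h3 : (n.factorial : ℝ) ≠ 0 := by positivity
        rw [if_pos hc, if_pos (by omega), normMarkedSum, normMarkedSum,
          Nat.cast_sub (show g₁ ≤ g by omega)]
        field_simp
        linear_combination (-markedSum τ M g₁ k * markedSum τ M (g - g₁) (n - k)) * hch'
      · rw [if_neg hc, if_neg (by omega), mul_zero, zero_div]

theorem mul_normMarkedSum (h : DVVFamily τ) (M : ℤ) (g n : ℕ) :
    (3 : ℝ) / 2 * (2 * g + n) * normMarkedSum τ M g n =
      shiftedSum τ M g n / (2 * n.factorial) +
      if 1 ≤ n then doublyMarkedSum τ M g (n - 1) / (4 * (n - 1).factorial) else 0 := by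
  rw [normMarkedSum]
  cases n with
  | zero =>
    have := mul_markedSum_zero h M g
    push_cast at this
    simp
    linarith
  | succ m =>
    have := mul_markedSum_succ h M g m
    push_cast at this
    rw [if_pos (by omega), Nat.add_sub_cancel, Nat.factorial_succ]
    push_cast
    have h1 : (m.factorial : ℝ) ≠ 0 := by positivity
    field_simp
    linarith

theorem levelSum_eq (h : DVVFamily τ) (M : ℤ) (N : ℕ) (hN : 3 ≤ N) (hM : 3 * (N : ℤ) ≤ M) :
    levelSum τ M N = (3 : ℝ) / 2 * (N - 1) * levelSum τ M (N - 1) +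
      ∑ i ∈ Finset.range (N + 1), if 2 ≤ i ∧ 2 ≤ N - i then
        levelSum τ M i * levelSum τ M (N - i) else 0 := by
  obtain ⟨K, rfl⟩ : ∃ K, N = K + 2 := ⟨N - 2, by omega⟩
  have h1 := Finset.sum_congr (rfl : levelPairs (K + 2) = _) fun p hp =>
    normMarkedSum_eq h M p.1 p.2 (by rw [mem_levelPairs] at hp; omega)
      (by rw [mem_levelPairs] at hp; omega)
  have h2 : (3 : ℝ) / 2 * (K + 1) * levelSum τ M (K + 1) =
      ∑ p ∈ levelPairs (K + 1), shiftedSum τ M p.1 p.2 / (2 * p.2.factorial) +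
      ∑ p ∈ levelPairs K, doublyMarkedSum τ M p.1 p.2 / (4 * p.2.factorial) := by
    rw [← sum_levelPairs_pred_right K fun g n => doublyMarkedSum τ M g n / (4 * n.factorial),
      ← Finset.sum_add_distrib, levelSum, Finset.mul_sum]
    refine Finset.sum_congr rfl fun p hp => ?_
    rw [mem_levelPairs] at hp
    rw [← mul_normMarkedSum h]
    have : (2 * p.1 + p.2 : ℝ) = K + 1 := by exact_mod_cast hp
    rw [this]
  simp only [levelSum]
  rw [h1, Finset.sum_add_distrib, Finset.sum_add_distrib,
    sum_levelPairs_pred_right (K + 1) fun g n => shiftedSum τ M g n / (2 * n.factorial),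
    sum_levelPairs_pred_left K fun g n => doublyMarkedSum τ M g n / (4 * n.factorial), ← h2,
    sum_levelPairs_split (K + 2) fun g n => normMarkedSum τ M g n]
  simp only [levelSum, show K + 2 - 1 = K + 1 by omega]
  push_cast
  ring

theorem mul_Tfun (h : DVVFamily τ) (M : ℤ) (N : ℕ) (hN : 1 ≤ N) (hM : 3 * (N : ℤ) ≤ M) {x : ℝ}
    (hx : 0 < x) :
    (3 : ℝ) / 2 * (N - 1) * Tfun τ N x = levelSum τ M N * x ^ ((3 : ℝ) / 2 * (N - 1)) := by
  rw [Tfun, levelSum, Finset.mul_sum, sum_levelPairs N fun g n => normMarkedSum τ M g n,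
    Finset.sum_mul]
  refine Finset.sum_congr rfl fun g _ => ?_
  split_ifs with hg
  · obtain ⟨n, rfl⟩ := Nat.exists_eq_add_of_le hg
    have h1 := fullSum_succ h M g n
    have h2 : ((n + 1).factorial : ℝ) = (n + 1) * n.factorial := by
      rw [Nat.factorial_succ]
      push_cast
      rfl
    have h3 : (n.factorial : ℝ) ≠ 0 := by positivity
    have h4 : (n : ℝ) + 1 ≠ 0 := by positivity
    have h5 : (2 * g - 2 + (n + 1 : ℕ) : ℝ) = (2 * g + n : ℕ) - 1 := by
      push_cast
      ring
    rw [Nat.add_sub_cancel_left, OmegaF_diagonal h g (n + 1) M (by push_cast at hM ⊢; omega) x hx,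
      h5, normMarkedSum, h2]
    push_cast at h1 ⊢
    field_simp
    linear_combination 2 * h1
  · simp

theorem hasDerivAt_Tfun (h : DVVFamily τ) (M : ℤ) (N : ℕ) (hN : 2 ≤ N) (hM : 3 * (N : ℤ) ≤ M)
    {x : ℝ} (hx : 0 < x) :
    HasDerivAt (Tfun τ N) (levelSum τ M N * x ^ ((3 : ℝ) / 2 * (N - 1) - 1)) x := by
  have hN' : (3 : ℝ) / 2 * (N - 1) ≠ 0 := by
    have : (2 : ℝ) ≤ N := by exact_mod_cast hN
    have : (0 : ℝ) < N - 1 := by linarith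
    positivity
  have h1 := ((Real.hasDerivAt_rpow_const (p := (3 : ℝ) / 2 * (N - 1)) (Or.inl hx.ne')).const_mul
    (levelSum τ M N / ((3 : ℝ) / 2 * (N - 1))))
  have h2 : levelSum τ M N / ((3 : ℝ) / 2 * (N - 1)) *
      ((3 : ℝ) / 2 * (N - 1) * x ^ ((3 : ℝ) / 2 * (N - 1) - 1)) =
      levelSum τ M N * x ^ ((3 : ℝ) / 2 * (N - 1) - 1) := by
    rw [← mul_assoc, div_mul_cancel₀ _ hN']
  rw [h2] at h1
  refine h1.congr_of_eventuallyEq ?_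
  filter_upwards [lt_mem_nhds hx] with y hy
  rw [div_mul_eq_mul_div, ← mul_Tfun h M N (by omega) hM hy, mul_div_cancel_left₀ _ hN']

theorem rpow_mul_deriv_Tfun (h : DVVFamily τ) (M : ℤ) (N : ℕ) (hN : 2 ≤ N)
    (hM : 3 * (N : ℤ) ≤ M) {x : ℝ} (hx : 0 < x) :
    x ^ ((5 : ℝ) / 2) * deriv (Tfun τ N) x = levelSum τ M N * x ^ ((3 : ℝ) / 2 * N) := by
  rw [(hasDerivAt_Tfun h M N hN hM hx).deriv, mul_left_comm, ← Real.rpow_add hx]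
  congr 2
  ring

theorem rpow_mul_deriv_rpow_mul_deriv_Tfun (h : DVVFamily τ) (M : ℤ) (N : ℕ) (hN : 2 ≤ N)
    (hM : 3 * (N : ℤ) ≤ M) {x : ℝ} (hx : 0 < x) :
    x ^ ((5 : ℝ) / 2) * deriv (fun y => y ^ ((5 : ℝ) / 2) * deriv (Tfun τ N) y) x =
      (3 : ℝ) / 2 * N * levelSum τ M N * x ^ ((3 : ℝ) / 2 * (N + 1)) := by
  have h1 : HasDerivAt (fun y => y ^ ((5 : ℝ) / 2) * deriv (Tfun τ N) y)
      (levelSum τ M N * ((3 : ℝ) / 2 * N * x ^ ((3 : ℝ) / 2 * N - 1))) x := by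
    refine ((Real.hasDerivAt_rpow_const (Or.inl hx.ne')).const_mul
      (levelSum τ M N)).congr_of_eventuallyEq ?_
    filter_upwards [lt_mem_nhds hx] with y hy
    exact rpow_mul_deriv_Tfun h M N hN hM hy
  have h2 : x ^ ((3 : ℝ) / 2 * (N + 1)) = x ^ ((5 : ℝ) / 2) * x ^ ((3 : ℝ) / 2 * N - 1) := by
    rw [← Real.rpow_add hx]
    congr 1
    ring
  rw [h1.deriv, h2]
  ring

end Correlators

/-- Equation (5.14) of the paper:
`w^{5/2} T_n'(w) = w^{5/2} (w^{5/2} T_{n-1}'(w))' + w⁵ Σ_{i+j=n, i,j≥2} T_i'(w) T_j'(w)`. -/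
theorem T_recursion (τ : ℤ → (n : ℕ) → (Fin n → ℤ) → ℝ) (h : DVVFamily τ)
    (n : ℕ) (hn : 3 ≤ n) (w : ℝ) (hw : 0 < w) :
    w ^ ((5 : ℝ) / 2) * deriv (Tfun τ n) w =
      w ^ ((5 : ℝ) / 2) *
        deriv (fun x => x ^ ((5 : ℝ) / 2) * deriv (Tfun τ (n - 1)) x) w
      + w ^ (5 : ℕ) *
          ∑ i ∈ Finset.range (n + 1),
            if 2 ≤ i ∧ 2 ≤ n - i then deriv (Tfun τ i) w * deriv (Tfun τ (n - i)) w else 0 := by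
  have hM : ∀ i : ℕ, i ≤ n → 3 * (i : ℤ) ≤ 3 * (n : ℤ) := fun i hi => by omega
  have h5 : w ^ (5 : ℕ) = w ^ ((5 : ℝ) / 2) * w ^ ((5 : ℝ) / 2) := by
    rw [← Real.rpow_add hw, ← Real.rpow_natCast]
    norm_num
  have hpred : (((n - 1 : ℕ) : ℝ)) = n - 1 := by
    rw [Nat.cast_sub (by omega), Nat.cast_one]
  have hquad : ∀ i ∈ Finset.range (n + 1), w ^ (5 : ℕ) *
      (if 2 ≤ i ∧ 2 ≤ n - i then deriv (Tfun τ i) w * deriv (Tfun τ (n - i)) w else 0) =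
      (if 2 ≤ i ∧ 2 ≤ n - i then levelSum τ (3 * n) i * levelSum τ (3 * n) (n - i) else 0) *
        w ^ ((3 : ℝ) / 2 * n) := by
    intro i hi
    split_ifs with hc
    · have hsum : w ^ ((3 : ℝ) / 2 * n) =
          w ^ ((3 : ℝ) / 2 * i) * w ^ ((3 : ℝ) / 2 * (n - i : ℕ)) := by
        rw [← Real.rpow_add hw, ← mul_add, ← Nat.cast_add, Nat.add_sub_cancel' (by omega)]
      rw [h5, mul_mul_mul_comm, rpow_mul_deriv_Tfun h (3 * n) i hc.1 (hM _ (by omega)) hw,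
        rpow_mul_deriv_Tfun h (3 * n) (n - i) hc.2 (hM _ (by omega)) hw, hsum]
      ring
    · simp
  rw [Finset.mul_sum, Finset.sum_congr rfl hquad, ← Finset.sum_mul,
    rpow_mul_deriv_Tfun h (3 * n) n (by omega) le_rfl hw,
    rpow_mul_deriv_rpow_mul_deriv_Tfun h (3 * n) (n - 1) (by omega) (hM _ (by omega)) hw, hpred,
    sub_add_cancel, ← add_mul, levelSum_eq h (3 * n) n hn le_rfl]
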